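/- arXiv:2108.01732 — 2 statements merged into one kernel-verified Lean document; each statement's English description precedes it below -/
import Mathlib

section
/- Assume the Setting. Let x, y ∈ L with y ≠ x and C_y = p + C_x for some p ∈ ℝ^n, and write Ω_x = C_x ∩ bd K and Ω_y = C_y ∩ bd K. Then Ω_x and Ω_y are inversely homothetic: there exist a point c ∈ ℝ^n and a ratio r < 0 such that Ω_y = {c + r·(z − c) : z ∈ Ω_x}. -/
open Set Metric RealInnerProductSpace

noncomputable section

/-- Euclidean space ℝ^n. -/
abbrev Euc (n : ℕ) := EuclideanSpace ℝ (Fin n)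

/-- The solid double-cone generated by a convex body `K` and a point `x`:
the union of all lines through `x` and a point of `K`. -/
def solidCone {n : ℕ} (K : Set (Euc n)) (x : Euc n) : Set (Euc n) :=
  ⋃ y ∈ K, (affineSpan ℝ ({x, y} : Set (Euc n)) : Set (Euc n))

/-- The support double-cone of `K` with apex `x`: the topological frontier of
the solid double-cone. -/
def supportCone {n : ℕ} (K : Set (Euc n)) (x : Euc n) : Set (Euc n) :=
  frontier (solidCone K x)

/-- A convex body: a compact convex set with nonempty interior. -/
def IsConvexBody {n : ℕ} (K : Set (Euc n)) : Prop :=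
  IsCompact K ∧ Convex ℝ K ∧ (interior K).Nonempty

/-- `M` is the image of a topological embedding of the sphere `S^m ⊆ ℝ^(m+1)`
into ℝ^n: a continuous injective map from the unit sphere with range `M`
(such a map from the compact sphere is automatically a homeomorphism onto its
image). -/
def IsSphereEmbeddingImage {n : ℕ} (m : ℕ) (M : Set (Euc n)) : Prop :=
  ∃ f : Metric.sphere (0 : Euc (m + 1)) 1 → Euc n,
    Continuous f ∧ Function.Injective f ∧ Set.range f = M

/-- `a` is a point of `K` maximizing `⟪·, ν⟫`. -/
def SupAt {n : ℕ} (K : Set (Euc n)) (ν a : Euc n) : Prop :=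
  a ∈ K ∧ ∀ z ∈ K, ⟪z, ν⟫ ≤ ⟪a, ν⟫

lemma exists_perp {n : ℕ} (hn : 3 ≤ n) (u v : Euc n) :
    ∃ k : Euc n, k ≠ 0 ∧ ⟪u, k⟫ = 0 ∧ ⟪v, k⟫ = 0 := by
  have hne : (Submodule.span ℝ ({u, v} : Set (Euc n)))ᗮ ≠ ⊥ := by
    intro h
    rw [Submodule.orthogonal_eq_bot_iff] at h
    have h1 := finrank_span_finset_le_card (R := ℝ) ({u, v} : Finset (Euc n))
    have h2 : ({u, v} : Finset (Euc n)).card ≤ 2 := Finset.card_le_two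
    unfold Set.finrank at h1
    rw [Finset.coe_pair, h, finrank_top, finrank_euclideanSpace_fin] at h1
    omega
  obtain ⟨k, hk, hk0⟩ := Submodule.exists_mem_ne_zero_of_ne_bot hne
  rw [Submodule.mem_orthogonal] at hk
  exact ⟨k, hk0, hk u (Submodule.subset_span (by simp)), hk v (Submodule.subset_span (by simp))⟩

lemma exists_supAt {n : ℕ} {K : Set (Euc n)} (hK : IsCompact K) (hne : K.Nonempty) (ν : Euc n) :
    ∃ a, SupAt K ν a := by
  obtain ⟨a, ha, h⟩ := hK.exists_isMaxOn hne (f := fun z => ⟪z, ν⟫) (by fun_prop)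
  exact ⟨a, ha, h⟩

lemma interior_lt {n : ℕ} {K : Set (Euc n)} {z0 : Euc n} (hz : z0 ∈ interior K) {k : Euc n}
    (hk : k ≠ 0) : ∃ z ∈ K, ⟪z0, k⟫ < ⟪z, k⟫ := by
  have hc : Filter.Tendsto (fun t : ℝ => z0 + t • k) (nhdsWithin 0 (Ioi 0)) (nhds z0) := by
    have : Continuous (fun t : ℝ => z0 + t • k) := by fun_prop
    have h := this.tendsto 0
    simp only [zero_smul, add_zero] at h
    exact h.mono_left nhdsWithin_le_nhds
  have h1 := hc.eventually (mem_interior_iff_mem_nhds.1 hz)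
  obtain ⟨t, ht, ht0⟩ := (h1.and self_mem_nhdsWithin).exists
  refine ⟨_, ht, ?_⟩
  rw [inner_add_left, real_inner_smul_left]
  have : 0 < ⟪k, k⟫ := real_inner_self_pos.2 hk
  have ht0 : 0 < t := ht0
  nlinarith [mul_pos ht0 this]

lemma supAt_unique {n : ℕ} {K : Set (Euc n)} (hKs : StrictConvex ℝ K) {ν a a' : Euc n}
    (hν : ν ≠ 0) (h : SupAt K ν a) (h' : SupAt K ν a') : a = a' := by
  by_contra hne
  have := hKs h.1 h'.1 hne (a := 1/2) (b := 1/2) (by norm_num) (by norm_num) (by norm_num)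
  obtain ⟨z, hz, hlt⟩ := interior_lt this hν
  have h1 := h.2 _ h'.1
  have h2 := h'.2 _ h.1
  have h3 := h.2 _ hz
  rw [inner_add_left, real_inner_smul_left, real_inner_smul_left] at hlt
  linarith

lemma sep {n : ℕ} {K : Set (Euc n)} (hK : IsCompact K) (hc : Convex ℝ K) (x e : Euc n)
    (h : ∀ t : ℝ, x + t • e ∉ K) :
    ∃ ν : Euc n, ⟪e, ν⟫ = 0 ∧ ∀ z ∈ K, ⟪z - x, ν⟫ < 0 := by
  let A : AffineSubspace ℝ (Euc n) := AffineSubspace.mk' x (Submodule.span ℝ {e})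
  have hA : ∀ w, w ∈ A ↔ ∃ t : ℝ, w = x + t • e := by
    intro w
    simp only [A, AffineSubspace.mem_mk', Submodule.mem_span_singleton, vsub_eq_sub]
    constructor
    · rintro ⟨t, ht⟩; exact ⟨t, by rw [ht]; abel⟩
    · rintro ⟨t, ht⟩; exact ⟨t, by rw [ht]; abel⟩
  have hcl : IsClosed (A : Set (Euc n)) := AffineSubspace.closed_of_finiteDimensional A
  have hd : Disjoint K (A : Set (Euc n)) := by
    rw [Set.disjoint_left]
    intro w hw hwA
    obtain ⟨t, rfl⟩ := (hA w).1 hwA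
    exact h t hw
  obtain ⟨f, u, v, h1, h2, h3⟩ := geometric_hahn_banach_compact_closed hc hK A.convex hcl hd
  have h3' : ∀ t : ℝ, v < f x + t * f e := by
    intro t
    have := h3 (x + t • e) ((hA _).2 ⟨t, rfl⟩)
    simpa using this
  have hfe : f e = 0 := by
    by_contra hne
    have := h3' ((v - f x) / f e)
    rw [div_mul_cancel₀ _ hne] at this
    linarith
  refine ⟨(InnerProductSpace.toDual ℝ (Euc n)).symm f, ?_, ?_⟩
  · rw [real_inner_comm, InnerProductSpace.toDual_symm_apply, hfe]
  · intro z hz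
    rw [real_inner_comm, InnerProductSpace.toDual_symm_apply, map_sub]
    have := h1 z hz
    have := h3' 0
    linarith

/-- tilting a strictly separating normal until it supports `K`. -/
lemma tilt {n : ℕ} {K : Set (Euc n)} (hK : IsCompact K) {x ν k : Euc n}
    (hν : ∀ z ∈ K, ⟪z - x, ν⟫ < 0) (hk : ∃ z ∈ K, 0 < ⟪z - x, k⟫) :
    ∃ t : ℝ, 0 < t ∧ ∃ a, SupAt K (ν + t • k) a ∧ ⟪a, ν + t • k⟫ = ⟪x, ν + t • k⟫ := by
  obtain ⟨z1, hz1, hz1k⟩ := hk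
  obtain ⟨a, ha, hmax⟩ := hK.exists_isMaxOn ⟨z1, hz1⟩
    (f := fun z => ⟪z - x, k⟫ / (-⟪z - x, ν⟫))
    (ContinuousOn.div (by fun_prop) (by fun_prop) (fun z hz => by have := hν z hz; linarith))
  have hpos : 0 < ⟪a - x, k⟫ / (-⟪a - x, ν⟫) :=
    lt_of_lt_of_le (div_pos hz1k (by linarith [hν z1 hz1])) (hmax hz1)
  set ρ := ⟪a - x, k⟫ / (-⟪a - x, ν⟫) with hρ
  have hna : 0 < -⟪a - x, ν⟫ := by linarith [hν a ha]
  have hae : ⟪a - x, k⟫ = ρ * (-⟪a - x, ν⟫) := by rw [hρ, div_mul_cancel₀ _ hna.ne']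
  have key : ∀ z, ⟪z - x, ν + ρ⁻¹ • k⟫ = ⟪z - x, ν⟫ + ρ⁻¹ * ⟪z - x, k⟫ := by
    intro z; rw [inner_add_right, real_inner_smul_right]
  have hz0 : ⟪a - x, ν + ρ⁻¹ • k⟫ = 0 := by
    rw [key, hae]; field_simp; ring
  refine ⟨ρ⁻¹, inv_pos.2 hpos, a, ⟨ha, fun z hz => ?_⟩, ?_⟩
  · have h1 : ⟪z - x, k⟫ / (-⟪z - x, ν⟫) ≤ ρ := hmax hz
    have h2 : 0 < -⟪z - x, ν⟫ := by linarith [hν z hz]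
    rw [div_le_iff₀ h2] at h1
    have h3 : ⟪z - x, ν + ρ⁻¹ • k⟫ ≤ 0 := by
      rw [key]
      have := mul_le_mul_of_nonneg_left h1 (inv_pos.2 hpos).le
      rw [← mul_assoc, inv_mul_cancel₀ hpos.ne'] at this
      linarith
    rw [inner_sub_left] at h3 hz0
    linarith
  · rw [inner_sub_left] at hz0
    linarith

lemma perp_span {n : ℕ} (hn : 3 ≤ n) {K : Set (Euc n)} (hK : IsCompact K)
    (hi : (interior K).Nonempty) {x e ν d : Euc n}
    (he : ⟪e, ν⟫ = 0) (hν : ∀ z ∈ K, ⟪z - x, ν⟫ < 0)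
    (hd : ∀ μ a, ⟪e, μ⟫ = 0 → SupAt K μ a → ⟪a, μ⟫ = ⟪x, μ⟫ → ⟪d, μ⟫ = 0) :
    ∃ m : ℝ, d = m • e := by
  obtain ⟨z0, hz0⟩ := hi
  have hz0K := interior_subset hz0
  have hstep : ∀ k : Euc n, k ≠ 0 → ⟪e, k⟫ = 0 → ⟪z0 - x, k⟫ = 0 →
      ⟪d, k⟫ = 0 ∧ ⟪d, ν⟫ = 0 := by
    intro k hk hek hzk
    have aux : ∀ k' : Euc n, k' ≠ 0 → ⟪e, k'⟫ = 0 → ⟪z0 - x, k'⟫ = 0 →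
        ∃ t : ℝ, 0 < t ∧ ⟪d, ν⟫ + t * ⟪d, k'⟫ = 0 := by
      intro k' hk' he' hz'
      obtain ⟨z, hz, hlt⟩ := interior_lt hz0 hk'
      obtain ⟨t, ht, a, ha, hax⟩ := tilt hK hν (k := k') ⟨z, hz, by
        rw [inner_sub_left] at hz' ⊢; linarith⟩
      have := hd _ a (by rw [inner_add_right, real_inner_smul_right, he, he']; simp) ha hax
      rw [inner_add_right, real_inner_smul_right] at this
      exact ⟨t, ht, this⟩
    obtain ⟨t, ht, h1⟩ := aux k hk hek hzk
    obtain ⟨s, hs, h2⟩ := aux (-k) (neg_ne_zero.2 hk) (by simp [hek]) (by simp [hzk])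
    rw [inner_neg_right] at h2
    have h3 : (t + s) * ⟪d, k⟫ = 0 := by linarith
    have h4 : ⟪d, k⟫ = 0 := by
      rcases mul_eq_zero.1 h3 with h | h
      · linarith
      · exact h
    rw [h4] at h1
    exact ⟨h4, by linarith⟩
  have hdν : ⟪d, ν⟫ = 0 := by
    obtain ⟨k, hk, h1, h2⟩ := exists_perp hn e (z0 - x)
    exact (hstep k hk h1 h2).2
  have hall : ∀ m : Euc n, ⟪e, m⟫ = 0 → ⟪d, m⟫ = 0 := by
    intro m hm
    set α := ⟪z0 - x, m⟫ / ⟪z0 - x, ν⟫ with hα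
    have hne : ⟪z0 - x, ν⟫ ≠ 0 := (hν z0 hz0K).ne
    have hk2 : ⟪z0 - x, m - α • ν⟫ = 0 := by
      rw [inner_sub_right, real_inner_smul_right, hα, div_mul_cancel₀ _ hne, sub_self]
    have hk1 : ⟪e, m - α • ν⟫ = 0 := by
      rw [inner_sub_right, real_inner_smul_right, he, hm]; simp
    have : ⟪d, m - α • ν⟫ = 0 := by
      by_cases h0 : m - α • ν = 0
      · rw [h0, inner_zero_right]
      · exact (hstep _ h0 hk1 hk2).1
    rw [inner_sub_right, real_inner_smul_right, hdν] at this
    linarith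
  have : d ∈ (Submodule.span ℝ {e})ᗮᗮ := by
    rw [Submodule.mem_orthogonal]
    intro u hu
    rw [real_inner_comm]
    exact hall u ((Submodule.mem_orthogonal _ _).1 hu e (Submodule.mem_span_singleton_self e))
  rw [Submodule.orthogonal_orthogonal, Submodule.mem_span_singleton] at this
  obtain ⟨m, hm⟩ := this
  exact ⟨m, hm.symm⟩

lemma segment_frontier {n : ℕ} {A : Set (Euc n)} {u w : Euc n} (hu : u ∈ A) (hw : w ∉ A) :
    ∃ r : ℝ, 0 ≤ r ∧ r ≤ 1 ∧ u + r • (w - u) ∈ frontier A := by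
  by_contra hcon
  push Not at hcon
  have hpre : IsPreconnected (segment ℝ u w) := (convex_segment u w).isPreconnected
  have hsub : segment ℝ u w ⊆ interior A ∪ (closure A)ᶜ := by
    intro v hv
    rw [segment_eq_image'] at hv
    obtain ⟨r, hr, rfl⟩ := hv
    have h := hcon r hr.1 hr.2
    by_contra h'
    simp only [mem_union, mem_compl_iff, not_or, not_not] at h'
    exact h ⟨h'.2, h'.1⟩
  have := hpre _ _ isOpen_interior isClosed_closure.isOpen_compl hsub
    ⟨u, left_mem_segment ℝ u w, (hsub (left_mem_segment ℝ u w)).resolve_right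
      (fun h => h (subset_closure hu))⟩
    ⟨w, right_mem_segment ℝ u w, (hsub (right_mem_segment ℝ u w)).resolve_left
      (fun h => hw (interior_subset h))⟩
  obtain ⟨v, -, hv1, hv2⟩ := this
  exact hv2 (subset_closure (interior_subset hv1))

/-- the double cone of directions. -/
def dirCone {n : ℕ} (K : Set (Euc n)) (x : Euc n) : Set (Euc n) :=
  {v | ∃ z ∈ K, ∃ t : ℝ, v = t • (z - x)}

lemma solidCone_eq {n : ℕ} (K : Set (Euc n)) (x : Euc n) :
    solidCone K x = (Homeomorph.addLeft x) '' dirCone K x := by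
  ext w
  simp only [solidCone, mem_iUnion, SetLike.mem_coe, exists_prop, mem_image, dirCone,
    mem_ofPred_eq, Homeomorph.coe_addLeft]
  constructor
  · rintro ⟨z, hz, hw⟩
    obtain ⟨t, rfl⟩ := (mem_affineSpan_pair_iff_exists_lineMap_eq).1 hw
    refine ⟨t • (z - x), ⟨z, hz, t, rfl⟩, ?_⟩
    rw [AffineMap.lineMap_apply]; simp [add_comm]
  · rintro ⟨v, ⟨z, hz, t, rfl⟩, rfl⟩
    refine ⟨z, hz, (mem_affineSpan_pair_iff_exists_lineMap_eq).2 ⟨t, ?_⟩⟩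
    rw [AffineMap.lineMap_apply]; simp [add_comm]

lemma mem_supportCone {n : ℕ} (K : Set (Euc n)) (x w : Euc n) :
    w ∈ supportCone K x ↔ w - x ∈ frontier (dirCone K x) := by
  rw [supportCone, solidCone_eq, ← Homeomorph.image_frontier]
  constructor
  · rintro ⟨v, hv, rfl⟩; simpa using hv
  · intro h; exact ⟨_, h, by simp⟩

lemma dirCone_closed {n : ℕ} {K : Set (Euc n)} (hK : IsCompact K) {x ν : Euc n}
    (hν : ∀ z ∈ K, ⟪z - x, ν⟫ < 0) : IsClosed (dirCone K x) := by
  have : CompactSpace K := isCompact_iff_compactSpace.1 hK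
  have hc : IsClosed {q : Euc n × K | ⟪(q.2 : Euc n) - x, ν⟫ • q.1 = ⟪q.1, ν⟫ • ((q.2 : Euc n) - x)} := by
    apply isClosed_eq <;> fun_prop
  have := isClosedMap_fst_of_compactSpace _ hc
  convert this using 1
  ext v
  simp only [dirCone, mem_ofPred_eq, mem_image, Prod.exists, Subtype.exists, exists_and_right,
    exists_eq_right]
  constructor
  · rintro ⟨z, hz, t, rfl⟩
    refine ⟨z, hz, ?_⟩
    simp only [real_inner_smul_left, smul_smul]
    rw [mul_comm]
  · rintro ⟨z, hz, h⟩
    refine ⟨z, hz, ⟪z - x, ν⟫⁻¹ * ⟪v, ν⟫, ?_⟩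
    have := (hν z hz).ne
    rw [mul_smul, ← h, smul_smul, inv_mul_cancel₀ this, one_smul]

lemma dirCone_perp {n : ℕ} {K : Set (Euc n)} {x ν : Euc n}
    (hν : ∀ z ∈ K, ⟪z - x, ν⟫ < 0) {v : Euc n} (hv : v ∈ dirCone K x) (h : ⟪v, ν⟫ = 0) : v = 0 := by
  obtain ⟨z, hz, t, rfl⟩ := hv
  rw [real_inner_smul_left] at h
  rcases mul_eq_zero.1 h with h | h
  · simp [h]
  · exact absurd h (hν z hz).ne

lemma dirCone_frontier_smul {n : ℕ} {K : Set (Euc n)} {x v : Euc n} {t : ℝ} (ht : t ≠ 0)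
    (hv : v ∈ frontier (dirCone K x)) : t • v ∈ frontier (dirCone K x) := by
  have h : (Homeomorph.smulOfNeZero t ht : Euc n ≃ₜ Euc n) '' dirCone K x = dirCone K x := by
    ext w
    constructor
    · rintro ⟨u, ⟨z, hz, s, rfl⟩, rfl⟩
      exact ⟨z, hz, t * s, by simp [smul_smul]⟩
    · rintro ⟨z, hz, s, rfl⟩
      exact ⟨(t⁻¹ * s) • (z - x), ⟨z, hz, _, rfl⟩, by simp [smul_smul, ht]⟩
  have h2 := (Homeomorph.smulOfNeZero t ht : Euc n ≃ₜ Euc n).image_frontier (dirCone K x)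
  rw [h] at h2
  rw [← h2]
  exact ⟨v, hv, rfl⟩

lemma zero_mem_frontier {n : ℕ} (hn : 3 ≤ n) {K : Set (Euc n)} (hne : K.Nonempty) {x ν : Euc n}
    (hν : ∀ z ∈ K, ⟪z - x, ν⟫ < 0) : (0 : Euc n) ∈ frontier (dirCone K x) := by
  obtain ⟨z, hz⟩ := hne
  refine ⟨subset_closure ⟨z, hz, 0, by simp⟩, fun h => ?_⟩
  obtain ⟨k, hk, h1, -⟩ := exists_perp hn ν ν
  have hc : Filter.Tendsto (fun t : ℝ => t • k) (nhdsWithin 0 (Ioi 0)) (nhds 0) := by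
    have : Continuous (fun t : ℝ => t • k) := by fun_prop
    have h := this.tendsto 0
    simp only [zero_smul] at h
    exact h.mono_left nhdsWithin_le_nhds
  have h1' := hc.eventually (mem_interior_iff_mem_nhds.1 h)
  obtain ⟨t, ht, ht0⟩ := (h1'.and self_mem_nhdsWithin).exists
  have ht0 : 0 < t := ht0
  have := dirCone_perp hν ht (by rw [real_inner_smul_left, real_inner_comm, h1, mul_zero])
  rw [smul_eq_zero] at this
  rcases this with h | h
  · exact ht0.ne' h
  · exact hk h

lemma frontier_not_line {n : ℕ} (hn : 3 ≤ n) {K : Set (Euc n)} (hK : IsCompact K)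
    (hi : (interior K).Nonempty) {x ν g : Euc n}
    (hν : ∀ z ∈ K, ⟪z - x, ν⟫ < 0)
    (h : ∀ v ∈ frontier (dirCone K x), ∃ α : ℝ, v = α • g) : False := by
  obtain ⟨z0, hz0⟩ := hi
  have hz0K := interior_subset hz0
  obtain ⟨k, hk, h1, -⟩ := exists_perp hn ν ν
  rw [real_inner_comm] at h1
  have ht0 : z0 - x ∈ interior (dirCone K x) := by
    have hsub : (Homeomorph.subRight x) '' K ⊆ dirCone K x := by
      rintro _ ⟨z, hz, rfl⟩
      exact ⟨z, hz, 1, by simp⟩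
    apply interior_mono hsub
    rw [← Homeomorph.image_interior]
    exact ⟨z0, hz0, rfl⟩
  have aux : ∀ k : Euc n, k ≠ 0 → ⟪k, ν⟫ = 0 → ∃ s α : ℝ, 0 < s ∧ s < 1 ∧
      (1 - s) • (z0 - x) + s • k = α • g := by
    intro k hk hkν
    have hkS : k ∉ dirCone K x := fun h => hk (dirCone_perp hν h hkν)
    obtain ⟨s, hs0, hs1, hs⟩ := segment_frontier (interior_subset ht0) hkS
    obtain ⟨α, hα⟩ := h _ hs
    refine ⟨s, α, lt_of_le_of_ne hs0 ?_, lt_of_le_of_ne hs1 ?_, ?_⟩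
    · rintro rfl
      simp only [zero_smul, add_zero] at hs
      exact hs.2 ht0
    · rintro rfl
      have e : (z0 - x) + (1 : ℝ) • (k - (z0 - x)) = k := by rw [one_smul]; abel
      rw [e] at hα hs
      exact hkS ((dirCone_closed hK hν).frontier_subset hs)
    · rw [← hα]; module
  obtain ⟨s, α, hs0, hs1, hs⟩ := aux k hk h1
  obtain ⟨s', β, hs0', hs1', hs'⟩ := aux (-k) (neg_ne_zero.2 hk) (by simp [h1])
  have hτ := hν z0 hz0K
  set τ := ⟪z0 - x, ν⟫ with hτd
  have e1 : (1 - s) * τ = α * ⟪g, ν⟫ := by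
    have := congrArg (fun v => ⟪v, ν⟫) hs
    simpa [inner_add_left, real_inner_smul_left, h1] using this
  have e2 : (1 - s') * τ = β * ⟪g, ν⟫ := by
    have := congrArg (fun v => ⟪v, ν⟫) hs'
    simpa [inner_add_left, real_inner_smul_left, h1] using this
  have e3 : ((1 - s) * β - (1 - s') * α) • (z0 - x) + (s * β + s' * α) • k = 0 := by
    have : β • ((1 - s) • (z0 - x) + s • k) - α • ((1 - s') • (z0 - x) + s' • (-k)) = 0 := by
      rw [hs, hs']; module
    rw [← this]; module
  have e4 : ((1 - s) * β - (1 - s') * α) = 0 := by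
    have := congrArg (fun v => ⟪v, ν⟫) e3
    simp only [inner_add_left, real_inner_smul_left, h1, inner_zero_left, mul_zero, add_zero] at this
    rcases mul_eq_zero.1 this with h | h
    · exact h
    · exact absurd h hτ.ne
  rw [e4, zero_smul, zero_add, smul_eq_zero] at e3
  have e5 : s * β + s' * α = 0 := e3.resolve_right hk
  have hα : α ≠ 0 := by
    rintro rfl
    have : (1 - s) * τ < 0 := mul_neg_of_pos_of_neg (by linarith) hτ
    linarith
  have hα2 : 0 < α ^ 2 := by positivity
  have e6 : (1 - s) * (α * β) = (1 - s') * α ^ 2 := by linear_combination α * e4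
  have e7 : s * (α * β) = - (s' * α ^ 2) := by linear_combination α * e5
  have p1 : 0 < (1 - s') * α ^ 2 := mul_pos (by linarith) hα2
  have p2 : 0 < s' * α ^ 2 := mul_pos (by linarith) hα2
  have p3 : 0 < α * β := by
    rw [← e6] at p1
    exact pos_of_mul_pos_right p1 (by linarith)
  have := mul_pos hs0 p3
  linarith

lemma apex_eq {n : ℕ} (hn : 3 ≤ n) {K : Set (Euc n)} (hK : IsCompact K)
    (hi : (interior K).Nonempty) {x y g ν : Euc n}
    (hν : ∀ z ∈ K, ⟪z - x, ν⟫ < 0)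
    (h : ∀ v, v ∈ frontier (dirCone K y) ↔ v + g ∈ frontier (dirCone K x)) : g = 0 := by
  by_contra hg
  have step : ∀ v ∈ frontier (dirCone K x), ∀ t : ℝ, t ≠ 0 →
      v - g + t⁻¹ • g ∈ frontier (dirCone K x) := by
    intro v hv t ht
    have h1 : v - g ∈ frontier (dirCone K y) := (h _).2 (by simpa using hv)
    have h2 := (h _).1 (dirCone_frontier_smul ht h1)
    have h3 := dirCone_frontier_smul (inv_ne_zero ht) h2
    rw [smul_add, smul_smul, inv_mul_cancel₀ ht, one_smul] at h3
    exact h3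
  have step1 : ∀ v ∈ frontier (dirCone K x), ∀ s : ℝ, s ≠ -1 →
      v + s • g ∈ frontier (dirCone K x) := by
    intro v hv s hs
    have hs' : s + 1 ≠ 0 := fun h => hs (by linarith)
    have := step v hv (s + 1)⁻¹ (inv_ne_zero hs')
    rw [inv_inv] at this
    convert this using 1
    module
  have step2 : ∀ v ∈ frontier (dirCone K x), ∀ s : ℝ, v + s • g ∈ frontier (dirCone K x) := by
    intro v hv s
    by_cases hs : s = -1
    · have h1 := step1 _ (step1 v hv (-1/2) (by norm_num)) (-1/2) (by norm_num)
      convert h1 using 1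
      rw [hs]; module
    · exact step1 v hv s hs
  have hcl := (dirCone_closed hK hν).frontier_subset
  have h0 := zero_mem_frontier hn (hi.mono interior_subset) hν
  have hgν : ⟪g, ν⟫ ≠ 0 := by
    intro h'
    have := step2 0 h0 1
    rw [zero_add, one_smul] at this
    exact hg (dirCone_perp hν (hcl this) h')
  refine frontier_not_line hn hK hi (g := g) hν (fun v hv => ⟨⟪v, ν⟫ / ⟪g, ν⟫, ?_⟩)
  have := dirCone_perp hν (hcl (step2 v hv (-(⟪v, ν⟫ / ⟪g, ν⟫)))) (by
    rw [inner_add_left, real_inner_smul_left, neg_mul, div_mul_cancel₀ _ hgν]; ring)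
  rw [neg_smul, ← sub_eq_add_neg, sub_eq_zero] at this
  exact this

lemma dirCone_comb {n : ℕ} {K : Set (Euc n)} (hc : Convex ℝ K) {x z z' : Euc n}
    (hz : z ∈ K) (hz' : z' ∈ K) {p t : ℝ} (hp : 0 ≤ p) (ht : 0 ≤ t) :
    ∃ w ∈ K, p • (z - x) + t • (z' - x) = (p + t) • (w - x) := by
  rcases eq_or_lt_of_le (add_nonneg hp ht) with h | h
  · have hp0 : p = 0 := by linarith
    have ht0 : t = 0 := by linarith
    exact ⟨z, hz, by simp [hp0, ht0]⟩
  · refine ⟨(p / (p + t)) • z + (t / (p + t)) • z', hc hz hz' (by positivity) (by positivity)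
      (by field_simp), ?_⟩
    have e1 : (p + t) * (p / (p + t)) = p := by field_simp
    have e2 : (p + t) * (t / (p + t)) = t := by field_simp
    rw [smul_sub (p + t), smul_add (p + t), smul_smul, smul_smul, e1, e2]
    module

lemma dirCone_comb' {n : ℕ} {K : Set (Euc n)} (hc : Convex ℝ K) {x z z' : Euc n}
    (hz : z ∈ K) (hz' : z' ∈ K) {p t : ℝ} (h : (0 ≤ p ∧ 0 ≤ t) ∨ (p ≤ 0 ∧ t ≤ 0)) :
    p • (z - x) + t • (z' - x) ∈ dirCone K x := by
  rcases h with ⟨h1, h2⟩ | ⟨h1, h2⟩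
  · obtain ⟨w, hw, e⟩ := dirCone_comb (x := x) hc hz hz' h1 h2
    exact ⟨w, hw, _, e⟩
  · obtain ⟨w, hw, e⟩ := dirCone_comb (x := x) hc hz hz' (neg_nonneg.2 h1) (neg_nonneg.2 h2)
    refine ⟨w, hw, p + t, ?_⟩
    have : p • (z - x) + t • (z' - x) = -(-p • (z - x) + -t • (z' - x)) := by module
    rw [this, e]; module

lemma dirCone_sub {n : ℕ} (hn : 3 ≤ n) {K : Set (Euc n)} (hK : IsCompact K) (hc : Convex ℝ K)
    (hne : K.Nonempty) {x y ν μ : Euc n}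
    (hν : ∀ z ∈ K, ⟪z - x, ν⟫ < 0) (hμ : ∀ z ∈ K, ⟪z - y, μ⟫ < 0)
    (h : frontier (dirCone K y) = frontier (dirCone K x)) : dirCone K y ⊆ dirCone K x := by
  intro v hvy
  by_contra hvx
  obtain ⟨z0, hz0⟩ := hne
  have hcl := (dirCone_closed hK hν).frontier_subset
  have h0x : (0 : Euc n) ∈ dirCone K x := ⟨z0, hz0, 0, by simp⟩
  have hτ := hν z0 hz0
  set τ := ⟪z0 - x, ν⟫ with hτd
  set σ := ⟪v, ν⟫ / τ with hσ
  have hστ : σ * τ = ⟪v, ν⟫ := div_mul_cancel₀ _ hτ.ne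
  have seg1 : ∀ r : ℝ, 0 ≤ r → r ≤ 1 → v - (r * σ) • (z0 - x) ∉ dirCone K x := by
    rintro r hr0 hr1 ⟨z, hz, t, ht⟩
    have e1 : (1 - r) * σ * τ = t * ⟪z - x, ν⟫ := by
      have := congrArg (fun v => ⟪v, ν⟫) ht
      simp only [inner_sub_left (v), real_inner_smul_left, ← hστ, ← hτd] at this
      linarith
    have hzν := hν z hz
    apply hvx
    have : v = (r * σ) • (z0 - x) + t • (z - x) := by rw [← ht]; abel
    rw [this]
    apply dirCone_comb' hc hz0 hz
    rcases le_total 0 σ with hs | hs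
    · left
      refine ⟨by positivity, ?_⟩
      by_contra hneg
      push Not at hneg
      have := mul_pos_of_neg_of_neg hneg hzν
      have : (1 - r) * σ * τ ≤ 0 :=
        mul_nonpos_of_nonneg_of_nonpos (mul_nonneg (by linarith) hs) hτ.le
      linarith
    · right
      refine ⟨mul_nonpos_of_nonneg_of_nonpos hr0 hs, ?_⟩
      by_contra hneg
      push Not at hneg
      have := mul_neg_of_pos_of_neg hneg hzν
      have : 0 ≤ (1 - r) * σ * τ :=
        mul_nonneg_of_nonpos_of_nonpos (mul_nonpos_of_nonneg_of_nonpos (by linarith) hs) hτ.le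
      linarith
  set w := v - σ • (z0 - x) with hw
  have hwx : w ∉ dirCone K x := by
    have := seg1 1 zero_le_one le_rfl
    rwa [one_mul] at this
  have hw0 : w ≠ 0 := fun h => hwx (h ▸ h0x)
  have hwν : ⟪w, ν⟫ = 0 := by
    rw [hw, inner_sub_left, real_inner_smul_left, ← hτd, hστ, sub_self]
  have hwy : w ∈ dirCone K y := by
    by_contra hwy
    obtain ⟨r, hr0, hr1, hr⟩ := segment_frontier hvy hwy
    rw [h] at hr
    apply seg1 r hr0 hr1
    have e : v + r • (w - v) = v - (r * σ) • (z0 - x) := by rw [hw]; module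
    rw [← e]
    exact hcl hr
  obtain ⟨k, hk, hk1, hk2⟩ := exists_perp hn ν μ
  rw [real_inner_comm] at hk1 hk2
  have aux : ∀ k : Euc n, k ≠ 0 → ⟪k, ν⟫ = 0 → ⟪k, μ⟫ = 0 →
      ∃ r : ℝ, 0 ≤ r ∧ r ≤ 1 ∧ w + r • (k - w) = 0 := by
    intro k hk hk1 hk2
    have hky : k ∉ dirCone K y := fun h => hk (dirCone_perp hμ h hk2)
    obtain ⟨r, hr0, hr1, hr⟩ := segment_frontier hwy hky
    rw [h] at hr
    refine ⟨r, hr0, hr1, dirCone_perp hν (hcl hr) ?_⟩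
    rw [inner_add_left, hwν, real_inner_smul_left, inner_sub_left k w, hk1, hwν]; simp
  obtain ⟨r, hr0, hr1, hr⟩ := aux k hk hk1 hk2
  obtain ⟨s, hs0, hs1, hs⟩ := aux (-k) (neg_ne_zero.2 hk) (by simp [hk1]) (by simp [hk2])
  have e : (s * (1 - r) + r * (1 - s)) • w = 0 := by
    have : (s * (1 - r) + r * (1 - s)) • w = s • (w + r • (k - w)) + r • (w + s • (-k - w)) := by
      module
    rw [this, hr, hs]; simp
  have e' := (smul_eq_zero.1 e).resolve_right hw0
  have a1 : 0 ≤ s * (1 - r) := mul_nonneg hs0 (by linarith)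
  have a2 : 0 ≤ r * (1 - s) := mul_nonneg hr0 (by linarith)
  have a3 : s * (1 - r) = 0 := by linarith
  rcases mul_eq_zero.1 a3 with h' | h'
  · rw [h'] at hs; simp at hs; exact hw0 hs
  · have : r = 1 := by linarith
    rw [this] at hr; simp at hr; exact hk hr

/-- Every support hyperplane of `K` through `x` has an opposite one through `y`, with
opposite contact directions. -/
def Partner {n : ℕ} (K : Set (Euc n)) (x y : Euc n) : Prop :=
  ∀ ν a, SupAt K ν a → ⟪a, ν⟫ = ⟪x, ν⟫ →
    ∃ b, ∃ s : ℝ, SupAt K (-ν) b ∧ s < 0 ∧ y - b = s • (x - a)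

lemma sign_dichotomy {n : ℕ} {K : Set (Euc n)} (hc : Convex ℝ K)
    {x y μ : Euc n} (hy : ∀ z ∈ K, ⟪z - y, μ⟫ < 0) (hx : x ∉ K)
    (h : ∀ z ∈ K, z - x ∈ dirCone K y) :
    (∀ z ∈ K, ∃ z' ∈ K, ∃ t : ℝ, 0 < t ∧ z - x = t • (z' - y)) ∨
    (∀ z ∈ K, ∃ z' ∈ K, ∃ t : ℝ, t < 0 ∧ z - x = t • (z' - y)) := by
  have hne : ∀ z ∈ K, ⟪z - x, μ⟫ ≠ 0 := by
    intro z hz h0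
    have := dirCone_perp hy (h z hz) h0
    rw [sub_eq_zero] at this
    exact hx (this ▸ hz)
  have hsgn : (∀ z ∈ K, ⟪z - x, μ⟫ < 0) ∨ (∀ z ∈ K, 0 < ⟪z - x, μ⟫) := by
    by_contra hcon
    push Not at hcon
    obtain ⟨⟨z, hz, h1⟩, z', hz', h2⟩ := hcon
    have := hc.isPreconnected.intermediate_value hz' hz
      (f := fun z => ⟪z - x, μ⟫) (by fun_prop)
    obtain ⟨w, hw, hw0⟩ := this ⟨h2, h1⟩
    exact hne w hw hw0
  rcases hsgn with hs | hs
  · left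
    intro z hz
    obtain ⟨z', hz', t, ht⟩ := h z hz
    refine ⟨z', hz', t, ?_, ht⟩
    have h1 := hs z hz
    rw [ht, real_inner_smul_left] at h1
    by_contra hneg
    push Not at hneg
    have := mul_nonneg_of_nonpos_of_nonpos hneg (hy z' hz').le
    linarith
  · right
    intro z hz
    obtain ⟨z', hz', t, ht⟩ := h z hz
    refine ⟨z', hz', t, ?_, ht⟩
    have h1 := hs z hz
    rw [ht, real_inner_smul_left] at h1
    by_contra hneg
    push Not at hneg
    have := mul_nonpos_of_nonneg_of_nonpos hneg (hy z' hz').le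
    linarith

lemma partner_of_translate {n : ℕ} (hn : 3 ≤ n) {K : Set (Euc n)} (hK : IsConvexBody K)
    {x y p : Euc n} (hx : x ∉ K) (hy : y ∉ K) (hxy : y ≠ x)
    (hp : supportCone K y = (fun z => p + z) '' supportCone K x) : Partner K x y := by
  obtain ⟨hKc, hc, hi⟩ := hK
  have hne := hi.mono interior_subset
  obtain ⟨ν, -, hν⟩ := sep hKc hc x 0 (by simpa using hx)
  obtain ⟨μ, -, hμ⟩ := sep hKc hc y 0 (by simpa using hy)
  have hD : ∀ v, v ∈ frontier (dirCone K y) ↔ v + (y - p - x) ∈ frontier (dirCone K x) := by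
    intro v
    have h1 : v ∈ frontier (dirCone K y) ↔ y + v ∈ supportCone K y := by
      rw [mem_supportCone]; simp
    rw [h1, hp]
    constructor
    · rintro ⟨w, hw, e⟩
      have e : p + w = y + v := e
      rw [mem_supportCone] at hw
      have : w - x = v + (y - p - x) := by rw [← add_sub_cancel_left p w, e]; abel
      rwa [← this]
    · intro hw
      refine ⟨v + y - p, ?_, ?_⟩
      · rw [mem_supportCone]
        convert hw using 1; abel
      · show p + (v + y - p) = y + v
        abel
  have hg := apex_eq hn hKc hi hν hD
  have hF : frontier (dirCone K y) = frontier (dirCone K x) := by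
    ext v; rw [hD, hg, add_zero]
  have hyx := dirCone_sub hn hKc hc hne hν hμ hF
  have hxy' := dirCone_sub hn hKc hc hne hμ hν hF.symm
  have hself : ∀ u, ∀ z ∈ K, z - u ∈ dirCone K u := fun u z hz => ⟨z, hz, 1, by simp⟩
  have d1 := sign_dichotomy hc hμ hx (fun z hz => hxy' (hself x z hz))
  have d2 := sign_dichotomy hc hν hy (fun z hz => hyx (hself y z hz))
  rcases d1 with d1 | d1
  · exfalso
    -- both cones are positively equal
    have d2' : ∀ z ∈ K, ∃ z' ∈ K, ∃ t : ℝ, 0 < t ∧ z - y = t • (z' - x) := by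
      rcases d2 with d2 | d2
      · exact d2
      · exfalso
        obtain ⟨z, hz⟩ := hne
        obtain ⟨z1, hz1, t, ht, e1⟩ := d1 z hz
        obtain ⟨z2, hz2, s, hs, e2⟩ := d2 z1 hz1
        rw [e2, smul_smul] at e1
        have := congrArg (fun v => ⟪v, ν⟫) e1
        simp only [real_inner_smul_left] at this
        have h1 := hν z hz
        have h2 := hν z2 hz2
        have h3 := mul_pos_of_neg_of_neg (mul_neg_of_pos_of_neg ht hs) h2
        linarith
    obtain ⟨m, hm⟩ := perp_span hn hKc hi (e := 0) (d := y - x) (by simp) hν (by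
      intro ρ a _ ha hax
      have h1 : ⟪y, ρ⟫ ≤ ⟪x, ρ⟫ := by
        obtain ⟨z', hz', t, ht, e⟩ := d1 a ha.1
        have := congrArg (fun v => ⟪v, ρ⟫) e
        simp only [real_inner_smul_left, inner_sub_left] at this
        have h2 := ha.2 z' hz'
        have h3 : t * (⟪z', ρ⟫ - ⟪y, ρ⟫) = 0 := by linarith
        have h4 := (mul_eq_zero.1 h3).resolve_left ht.ne'
        linarith
      have h2 : ⟪x, ρ⟫ ≤ ⟪y, ρ⟫ := by
        obtain ⟨z', hz', t, ht, e⟩ := d2' a ha.1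
        have := congrArg (fun v => ⟪v, ρ⟫) e
        simp only [real_inner_smul_left, inner_sub_left] at this
        have h2 := ha.2 z' hz'
        have h3 : t * (⟪z', ρ⟫ - ⟪x, ρ⟫) ≤ 0 :=
          mul_nonpos_of_nonneg_of_nonpos ht.le (by linarith)
        linarith
      rw [inner_sub_left]; linarith)
    rw [smul_zero, sub_eq_zero] at hm
    exact hxy hm
  · have d2' : ∀ z ∈ K, ∃ z' ∈ K, ∃ t : ℝ, t < 0 ∧ z - y = t • (z' - x) := by
      rcases d2 with d2 | d2
      · exfalso
        obtain ⟨z, hz⟩ := hne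
        obtain ⟨z1, hz1, t, ht, e1⟩ := d1 z hz
        obtain ⟨z2, hz2, s, hs, e2⟩ := d2 z1 hz1
        rw [e2, smul_smul] at e1
        have := congrArg (fun v => ⟪v, ν⟫) e1
        simp only [real_inner_smul_left] at this
        have h1 := hν z hz
        have h2 := hν z2 hz2
        have h3 := mul_pos_of_neg_of_neg (mul_neg_of_neg_of_pos ht hs) h2
        linarith
      · exact d2
    intro ρ a ha hax
    obtain ⟨b, hb, t, ht, e⟩ := d1 a ha.1
    have hby : ⟪b, ρ⟫ = ⟪y, ρ⟫ := by
      have := congrArg (fun v => ⟪v, ρ⟫) e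
      simp only [real_inner_smul_left, inner_sub_left] at this
      have h3 : t * (⟪b, ρ⟫ - ⟪y, ρ⟫) = 0 := by linarith
      have h4 := (mul_eq_zero.1 h3).resolve_left ht.ne
      linarith
    refine ⟨b, t⁻¹, ⟨hb, fun z hz => ?_⟩, inv_lt_zero.2 ht, ?_⟩
    · obtain ⟨z', hz', s, hs, e'⟩ := d2' z hz
      have := congrArg (fun v => ⟪v, ρ⟫) e'
      simp only [real_inner_smul_left, inner_sub_left] at this
      have h2 := ha.2 z' hz'
      have h3 : 0 ≤ s * (⟪z', ρ⟫ - ⟪x, ρ⟫) :=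
        mul_nonneg_of_nonpos_of_nonpos hs.le (by linarith)
      rw [inner_neg_right, inner_neg_right]
      linarith
    · have : x - a = t • (y - b) := by
        rw [← neg_sub a x, e]; module
      rw [this, smul_smul, inv_mul_cancel₀ ht.ne, one_smul]

lemma ray_hit {n : ℕ} {L : Set (Euc n)} {z0 : Euc n}
    (hb : Bornology.IsBounded (connectedComponentIn Lᶜ z0)) {c u : Euc n}
    (hc : c ∈ connectedComponentIn Lᶜ z0) (hu : u ≠ 0) : ∃ t : ℝ, 0 < t ∧ c + t • u ∈ L := by
  by_contra hcon
  push Not at hcon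
  have hcL : c ∈ Lᶜ := connectedComponentIn_subset _ _ hc
  have hpre : IsPreconnected ((fun t : ℝ => c + t • u) '' Ici 0) :=
    isPreconnected_Ici.image _ (by fun_prop)
  have hsub : (fun t : ℝ => c + t • u) '' Ici 0 ⊆ Lᶜ := by
    rintro _ ⟨t, ht, rfl⟩
    rcases eq_or_lt_of_le (show (0 : ℝ) ≤ t from ht) with h | h
    · subst h; simpa using hcL
    · exact hcon t h
  have h1 := hpre.subset_connectedComponentIn (x := c) ⟨0, by simp, by simp⟩ hsub
  rw [← connectedComponentIn_eq hc] at h1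
  obtain ⟨R, hR⟩ := (hb.subset h1).exists_norm_le
  have hun : 0 < ‖u‖ := norm_pos_iff.2 hu
  have hR0 : 0 ≤ R := le_trans (norm_nonneg _) (hR _ ⟨0, by simp, rfl⟩)
  set t := (R + ‖c‖ + 1) / ‖u‖ with ht
  have ht0 : 0 ≤ t := by positivity
  have h2 := hR _ ⟨t, ht0, rfl⟩
  have h3 : ‖t • u‖ = R + ‖c‖ + 1 := by
    rw [norm_smul, Real.norm_of_nonneg ht0, ht, div_mul_cancel₀ _ hun.ne']
  have h4 : ‖t • u‖ ≤ ‖c + t • u‖ + ‖c‖ := by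
    have := norm_sub_le (c + t • u) c
    rwa [add_sub_cancel_left] at this
  have h2' : ‖c + t • u‖ ≤ R := h2
  linarith

lemma partner_parallel {n : ℕ} (hn : 3 ≤ n) {K : Set (Euc n)} (hK : IsConvexBody K)
    {x x' y y' : Euc n} (h : Partner K x y) (h' : Partner K x' y')
    (hl : ∀ t : ℝ, x + t • (x - x') ∉ K) : ∃ m : ℝ, y - y' = m • (x - x') := by
  obtain ⟨hKc, hc, hi⟩ := hK
  obtain ⟨ν, he, hν⟩ := sep hKc hc x (x - x') hl
  refine perp_span hn hKc hi he hν ?_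
  intro μ a hμ ha hax
  rw [inner_sub_left] at hμ
  obtain ⟨b, s, hb, -, e⟩ := h μ a ha hax
  obtain ⟨b', s', hb', -, e'⟩ := h' μ a ha (by linarith)
  have h1 := congrArg (fun v => ⟪v, μ⟫) e
  have h2 := congrArg (fun v => ⟪v, μ⟫) e'
  simp only [real_inner_smul_left, inner_sub_left] at h1 h2
  rw [show ⟪x, μ⟫ - ⟪a, μ⟫ = 0 by linarith, mul_zero] at h1
  rw [show ⟪x', μ⟫ - ⟪a, μ⟫ = 0 by linarith, mul_zero] at h2
  have h3 := hb.2 b' hb'.1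
  have h4 := hb'.2 b hb.1
  rw [inner_neg_right, inner_neg_right] at h3 h4
  rw [inner_sub_left]
  linarith

lemma hyper {n : ℕ} (hn : 3 ≤ n) {K L : Set (Euc n)} (hK : IsConvexBody K)
    (hKs : StrictConvex ℝ K) (hKL : ∀ x ∈ L, x ∉ K) {f : Euc n → Euc n}
    (hf : ∀ x ∈ L, Partner K x (f x)) {ν a b : Euc n} (hν : ν ≠ 0)
    (ha : SupAt K ν a) (hb : SupAt K (-ν) b)
    (hit : ∀ u : Euc n, u ≠ 0 → ∃ t : ℝ, 0 < t ∧ a + t • u ∈ L) :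
    ∃ l : ℝ, ∀ x ∈ L, ⟪x, ν⟫ = ⟪a, ν⟫ → f x = b + l • (x - a) := by
  have hs : ∀ x ∈ L, ⟪x, ν⟫ = ⟪a, ν⟫ → ∃ s : ℝ, f x = b + s • (x - a) := by
    intro x hx hxν
    obtain ⟨b', s, hb', -, e⟩ := hf x hx ν a ha hxν.symm
    have := supAt_unique hKs (neg_ne_zero.2 hν) hb' hb
    subst this
    exact ⟨s, by rw [← e]; abel⟩
  have hxa : ∀ x ∈ L, x - a ≠ 0 := by
    intro x hx h
    rw [sub_eq_zero] at h
    exact hKL x hx (h ▸ ha.1)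
  have pair : ∀ x ∈ L, ∀ x' ∈ L, ⟪x, ν⟫ = ⟪a, ν⟫ → ⟪x', ν⟫ = ⟪a, ν⟫ →
      (∀ α β : ℝ, α • (x - a) + β • (x' - a) = 0 → α = 0 ∧ β = 0) →
      ∀ s s' : ℝ, f x = b + s • (x - a) → f x' = b + s' • (x' - a) → s = s' := by
    intro x hx x' hx' hxν hxν' hind s s' e e'
    obtain ⟨m, hm⟩ := partner_parallel hn hK (hf x hx) (hf x' hx') (by
      intro t ht
      have hsup : SupAt K ν (x + t • (x - x')) := by
        refine ⟨ht, fun z hz => ?_⟩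
        rw [inner_add_left, real_inner_smul_left, inner_sub_left, hxν, hxν']
        simpa using ha.2 z hz
      have h1 := supAt_unique hKs hν hsup ha
      have h2 : (1 + t) • (x - a) + (-t) • (x' - a) = 0 := by
        have : (1 + t) • (x - a) + (-t) • (x' - a) = (x + t • (x - x')) - a := by module
        rw [this, h1, sub_self]
      obtain ⟨h3, h4⟩ := hind _ _ h2
      linarith)
    rw [e, e'] at hm
    have h2 : (s - m) • (x - a) + (m - s') • (x' - a) = 0 := by
      have : (s - m) • (x - a) + (m - s') • (x' - a) =
        (b + s • (x - a) - (b + s' • (x' - a))) - m • (x - x') := by module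
      rw [this, hm, sub_self]
    obtain ⟨h3, h4⟩ := hind _ _ h2
    linarith
  obtain ⟨k0, hk0, hk0ν, -⟩ := exists_perp hn ν ν
  obtain ⟨t0, ht0, hx0⟩ := hit k0 hk0
  set x0 := a + t0 • k0 with hx0d
  have hx0ν : ⟪x0, ν⟫ = ⟪a, ν⟫ := by
    rw [hx0d, inner_add_left, real_inner_smul_left, real_inner_comm, real_inner_comm ν k0, hk0ν,
      mul_zero, add_zero, real_inner_comm]
  obtain ⟨s0, hs0⟩ := hs x0 hx0 hx0ν
  refine ⟨s0, fun x hx hxν => ?_⟩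
  obtain ⟨s, hsx⟩ := hs x hx hxν
  suffices s = s0 by rw [hsx, this]
  by_cases hind : ∀ α β : ℝ, α • (x - a) + β • (x0 - a) = 0 → α = 0 ∧ β = 0
  · exact pair x hx x0 hx0 hxν hx0ν hind s s0 hsx hs0
  · push Not at hind
    obtain ⟨α, β, hαβ, hnz⟩ := hind
    obtain ⟨k, hk, hkν, hkx⟩ := exists_perp hn ν (x0 - a)
    have hα : α ≠ 0 := by
      intro h0
      rw [h0, zero_smul, zero_add, smul_eq_zero] at hαβ
      exact hnz h0 (hαβ.resolve_right (hxa x0 hx0))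
    have hkx' : ⟪x - a, k⟫ = 0 := by
      have := congrArg (fun v => ⟪v, k⟫) hαβ
      simp only [inner_add_left, real_inner_smul_left, hkx, inner_zero_left, mul_zero,
        add_zero] at this
      exact (mul_eq_zero.1 this).resolve_left hα
    obtain ⟨t, ht, hx1⟩ := hit k hk
    have hx1ν : ⟪a + t • k, ν⟫ = ⟪a, ν⟫ := by
      rw [inner_add_left, real_inner_smul_left, real_inner_comm ν k, hkν, mul_zero, add_zero]
    obtain ⟨s1, hs1⟩ := hs _ hx1 hx1ν
    have indk : ∀ w ∈ L, ⟪w - a, k⟫ = 0 →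
        ∀ α β : ℝ, α • (w - a) + β • ((a + t • k) - a) = 0 → α = 0 ∧ β = 0 := by
      intro w hw hwk α β h
      rw [add_sub_cancel_left] at h
      have h1 := congrArg (fun v => ⟪v, k⟫) h
      simp only [inner_add_left, real_inner_smul_left, hwk, inner_zero_left, mul_zero,
        zero_add] at h1
      have hkk : ⟪k, k⟫ ≠ 0 := (real_inner_self_pos.2 hk).ne'
      have hβ : β = 0 := by
        rcases mul_eq_zero.1 h1 with h | h
        · exact h
        · exact absurd h (mul_ne_zero ht.ne' hkk)
      rw [hβ, zero_smul, add_zero, smul_eq_zero] at h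
      exact ⟨h.resolve_right (hxa w hw), hβ⟩
    rw [pair x hx _ hx1 hxν hx1ν (indk x hx hkx') s s1 hsx hs1,
      pair x0 hx0 _ hx1 hx0ν hx1ν (indk x0 hx0 hkx) s0 s1 hs0 hs1]

lemma near_inter {n : ℕ} {K : Set (Euc n)} (hK : IsCompact K) (hKs : StrictConvex ℝ K)
    {ν a : Euc n} (hν : ‖ν‖ = 1) (ha : SupAt K ν a) {δ : ℝ} (hδ : 0 < δ) :
    ∃ ε : ℝ, 0 < ε ∧ ∀ ν' a', ‖ν'‖ = 1 → ν' ≠ ν → ‖ν' - ν‖ < ε → SupAt K ν' a' →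
      ∃ c, ⟪c, ν⟫ = ⟪a, ν⟫ ∧ ⟪c, ν'⟫ = ⟪a', ν'⟫ ∧ ‖c - a‖ < δ := by
  have hν0 : ν ≠ 0 := by rintro rfl; simp at hν
  have hstab : ∃ η : ℝ, 0 < η ∧ ∀ z ∈ K, ⟪a, ν⟫ - η < ⟪z, ν⟫ → ‖z - a‖ < δ / 2 := by
    have hcomp : IsCompact (K \ ball a (δ / 2)) := hK.diff isOpen_ball
    rcases (K \ ball a (δ / 2)).eq_empty_or_nonempty with hem | hne
    · refine ⟨1, one_pos, fun z hz _ => ?_⟩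
      by_contra hlt
      have : z ∈ K \ ball a (δ / 2) := ⟨hz, by rwa [mem_ball, dist_eq_norm]⟩
      rw [hem] at this
      exact this
    · obtain ⟨z1, hz1, hmax⟩ := hcomp.exists_isMaxOn hne (f := fun z => ⟪z, ν⟫) (by fun_prop)
      have hlt : ⟪z1, ν⟫ < ⟪a, ν⟫ := by
        refine lt_of_le_of_ne (ha.2 z1 hz1.1) fun he => hz1.2 ?_
        have : SupAt K ν z1 := ⟨hz1.1, fun z hz => by rw [he]; exact ha.2 z hz⟩
        rw [supAt_unique hKs hν0 this ha]
        exact mem_ball_self (by linarith)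
      refine ⟨⟪a, ν⟫ - ⟪z1, ν⟫, by linarith, fun z hz hzl => ?_⟩
      by_contra hlt'
      have h1 : z ∈ K \ ball a (δ / 2) := ⟨hz, by rwa [mem_ball, dist_eq_norm]⟩
      have h2 : ⟪z, ν⟫ ≤ ⟪z1, ν⟫ := hmax h1
      linarith
  obtain ⟨η, hη, hstab⟩ := hstab
  obtain ⟨R, hR⟩ := hK.isBounded.exists_norm_le
  have hR0 : 0 ≤ R := le_trans (norm_nonneg _) (hR a ha.1)
  refine ⟨min 1 (η / (2 * R + 1)), lt_min one_pos (by positivity), ?_⟩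
  intro ν' a' hν' hne hclose ha'
  have hc1 : ‖ν' - ν‖ < 1 := lt_of_lt_of_le hclose (min_le_left _ _)
  have hc2 : ‖ν' - ν‖ < η / (2 * R + 1) := lt_of_lt_of_le hclose (min_le_right _ _)
  rw [lt_div_iff₀ (by positivity)] at hc2
  have hM : ‖a' - a‖ ≤ 2 * R := by
    have := norm_sub_le a' a
    linarith [hR a ha.1, hR a' ha'.1]
  have hcs : ⟪a' - a, ν' - ν⟫ ≤ ‖a' - a‖ * ‖ν' - ν‖ := real_inner_le_norm _ _
  have hexp : ⟪a' - a, ν' - ν⟫ = ⟪a' - a, ν'⟫ - ⟪a' - a, ν⟫ := inner_sub_right _ _ _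
  have hD0 : 0 ≤ ⟪a' - a, ν'⟫ := by
    rw [inner_sub_left]; linarith [ha'.2 a ha.1]
  have hD1 : ⟪a' - a, ν⟫ ≤ 0 := by
    rw [inner_sub_left]; linarith [ha.2 a' ha'.1]
  have hnn : 0 ≤ ‖ν' - ν‖ := norm_nonneg _
  have hclose2 : ‖a' - a‖ < δ / 2 := by
    apply hstab a' ha'.1
    have h1 : ‖a' - a‖ * ‖ν' - ν‖ ≤ 2 * R * ‖ν' - ν‖ := mul_le_mul_of_nonneg_right hM hnn
    have h2 : ⟪a' - a, ν⟫ = ⟪a', ν⟫ - ⟪a, ν⟫ := inner_sub_left _ _ _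
    nlinarith
  set s := ⟪ν, ν'⟫ with hs
  have hνν : ⟪ν, ν⟫ = 1 := by rw [real_inner_self_eq_norm_sq, hν]; norm_num
  have hνν' : ⟪ν', ν'⟫ = 1 := by rw [real_inner_self_eq_norm_sq, hν']; norm_num
  have hsc : ⟪ν', ν⟫ = s := by rw [hs, real_inner_comm]
  have hnsq : ‖ν' - ν‖ ^ 2 = 2 - 2 * s := by
    rw [← real_inner_self_eq_norm_sq, inner_sub_left, inner_sub_right, inner_sub_right, hνν, hνν',
      hsc, ← hs]; ring
  have hpos : 0 < ‖ν' - ν‖ := norm_pos_iff.2 (sub_ne_zero.2 hne)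
  have hs1 : s < 1 := by nlinarith
  have hs0 : 0 < s := by nlinarith
  have h1s : 0 < 1 - s ^ 2 := by nlinarith
  set D := ⟪a' - a, ν'⟫ with hD
  have hDle : D ≤ ‖a' - a‖ * ‖ν' - ν‖ := by linarith
  set w := ν' - s • ν with hw
  have hw1 : ⟪w, ν⟫ = 0 := by
    rw [hw, inner_sub_left, real_inner_smul_left, hνν, hsc]; ring
  have hw2 : ⟪w, ν'⟫ = 1 - s ^ 2 := by
    rw [hw, inner_sub_left, real_inner_smul_left, hνν', ← hs]; ring
  have hw3 : ‖w‖ ^ 2 = 1 - s ^ 2 := by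
    rw [← real_inner_self_eq_norm_sq]
    conv_lhs => rw [hw]
    rw [← hw, hw] at *
    rw [inner_sub_right, real_inner_smul_right, hw1, hw2]; ring
  refine ⟨a + (D / (1 - s ^ 2)) • w, ?_, ?_, ?_⟩
  · rw [inner_add_left, real_inner_smul_left, hw1]; ring
  · rw [inner_add_left, real_inner_smul_left, hw2, div_mul_cancel₀ _ h1s.ne', hD, inner_sub_left]
    ring
  · rw [add_sub_cancel_left]
    have h1 : ‖(D / (1 - s ^ 2)) • w‖ ^ 2 = D ^ 2 / (1 - s ^ 2) := by
      rw [norm_smul, mul_pow, hw3, Real.norm_eq_abs, sq_abs]; field_simp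
    have h2 : D ^ 2 ≤ ‖a' - a‖ ^ 2 * (2 - 2 * s) := by
      rw [← hnsq, ← mul_pow]
      exact pow_le_pow_left₀ hD0 hDle 2
    have h3 : D ^ 2 / (1 - s ^ 2) ≤ ‖a' - a‖ ^ 2 * 2 := by
      rw [div_le_iff₀ h1s]
      refine h2.trans ?_
      rw [mul_assoc]
      apply mul_le_mul_of_nonneg_left _ (sq_nonneg _)
      nlinarith
    have h4 : ‖a' - a‖ ^ 2 < (δ / 2) ^ 2 := pow_lt_pow_left₀ hclose2 (norm_nonneg _) two_ne_zero
    refine lt_of_pow_lt_pow_left₀ 2 hδ.le ?_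
    rw [h1]
    nlinarith

lemma SupAt.smul {n : ℕ} {K : Set (Euc n)} {ν a : Euc n} (h : SupAt K ν a) {c : ℝ} (hc : 0 ≤ c) :
    SupAt K (c • ν) a := by
  refine ⟨h.1, fun z hz => ?_⟩
  rw [real_inner_smul_right, real_inner_smul_right]
  exact mul_le_mul_of_nonneg_left (h.2 z hz) hc

lemma exists_support_through {n : ℕ} (hn : 3 ≤ n) {K : Set (Euc n)} (hK : IsConvexBody K)
    {x : Euc n} (hx : x ∉ K) : ∃ ν a, ν ≠ 0 ∧ SupAt K ν a ∧ ⟪a, ν⟫ = ⟪x, ν⟫ := by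
  obtain ⟨hKc, hc, z0, hz0⟩ := hK
  obtain ⟨ν, -, hν⟩ := sep hKc hc x 0 (by simpa using hx)
  obtain ⟨k, hk, hk1, -⟩ := exists_perp hn (z0 - x) (z0 - x)
  obtain ⟨z, hz, hlt⟩ := interior_lt hz0 hk
  obtain ⟨t, ht, a, ha, hax⟩ := tilt hKc hν (k := k) ⟨z, hz, by
    rw [inner_sub_left] at hk1 ⊢; linarith⟩
  refine ⟨_, a, ?_, ha, hax⟩
  intro h0
  have h1 : ⟪z0 - x, ν + t • k⟫ = ⟪z0 - x, ν⟫ := by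
    rw [inner_add_right, real_inner_smul_right, hk1, mul_zero, add_zero]
  rw [h0, inner_zero_right] at h1
  linarith [hν z0 (interior_subset hz0)]

/-- The global conclusion: `K` is centrally symmetric and `f` is the central symmetry on `L`. -/
lemma central {n : ℕ} (hn : 3 ≤ n) {K L : Set (Euc n)} (hK : IsConvexBody K)
    (hKs : StrictConvex ℝ K) (hLc : IsClosed L) {z0 : Euc n}
    (hb : Bornology.IsBounded (connectedComponentIn Lᶜ z0))
    (hsub : K ⊆ connectedComponentIn Lᶜ z0) {f : Euc n → Euc n}
    (hf : ∀ x ∈ L, Partner K x (f x)) :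
    ∃ q : Euc n, (∀ x ∈ L, f x = q - x) ∧ ∀ z ∈ K, q - z ∈ K := by
  have hK' := hK
  obtain ⟨hKc, hc, hi⟩ := hK'
  have hne := hi.mono interior_subset
  have hKL : ∀ x ∈ L, x ∉ K := fun x hx hxK => connectedComponentIn_subset _ _ (hsub hxK) hx
  have hUo : IsOpen (connectedComponentIn Lᶜ z0) := hLc.isOpen_compl.connectedComponentIn
  have hunit : ∀ ν : sphere (0 : Euc n) 1, ‖(ν : Euc n)‖ = 1 := fun ν => by
    simpa using ν.2
  have hnz : ∀ ν : sphere (0 : Euc n) 1, (ν : Euc n) ≠ 0 := fun ν h => by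
    have := hunit ν; rw [h] at this; simp at this
  have hex : ∀ ν : sphere (0 : Euc n) 1, ∃ Q : Euc n × ℝ, ∀ a b, SupAt K ν a →
      SupAt K (-(ν : Euc n)) b → b = Q.1 + Q.2 • a ∧
        ∀ x ∈ L, ⟪x, (ν : Euc n)⟫ = ⟪a, (ν : Euc n)⟫ → f x = Q.1 + Q.2 • x := by
    intro ν
    obtain ⟨a, ha⟩ := exists_supAt hKc hne (ν : Euc n)
    obtain ⟨b, hb'⟩ := exists_supAt hKc hne (-(ν : Euc n))
    obtain ⟨l, hl⟩ := hyper hn hK hKs hKL hf (hnz ν) ha hb'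
      (fun u hu => ray_hit hb (hsub ha.1) hu)
    refine ⟨(b - l • a, l), fun a1 b1 ha1 hb1 => ?_⟩
    rw [supAt_unique hKs (hnz ν) ha1 ha, supAt_unique hKs (neg_ne_zero.2 (hnz ν)) hb1 hb']
    refine ⟨by simp, fun x hx hxν => ?_⟩
    rw [hl x hx hxν]
    simp only
    module
  choose Q hQ using hex
  have hloc : IsLocallyConstant Q := by
    rw [IsLocallyConstant.iff_eventually_eq]
    intro ν
    obtain ⟨a, ha⟩ := exists_supAt hKc hne (ν : Euc n)
    obtain ⟨b, hb'⟩ := exists_supAt hKc hne (-(ν : Euc n))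
    obtain ⟨δ, hδ, hball⟩ := Metric.isOpen_iff.1 hUo a (hsub ha.1)
    obtain ⟨ε, hε, hnear⟩ := near_inter hKc hKs (hunit ν) ha hδ
    rw [Metric.eventually_nhds_iff]
    refine ⟨ε, hε, fun ν' hν' => ?_⟩
    by_cases heq : ν' = ν
    · rw [heq]
    obtain ⟨a', ha'⟩ := exists_supAt hKc hne (ν' : Euc n)
    obtain ⟨b', hb''⟩ := exists_supAt hKc hne (-(ν' : Euc n))
    have hd : ‖(ν' : Euc n) - ν‖ < ε := by
      rwa [Subtype.dist_eq, dist_eq_norm] at hν'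
    obtain ⟨c, hc1, hc2, hc3⟩ := hnear ν' a' (hunit ν') (fun h => heq (Subtype.ext h)) hd ha'
    have hcU : c ∈ connectedComponentIn Lᶜ z0 := hball (by rwa [mem_ball, dist_eq_norm])
    obtain ⟨u, hu, hu1, hu2⟩ := exists_perp hn (ν : Euc n) (ν' : Euc n)
    rw [real_inner_comm] at hu1 hu2
    obtain ⟨t1, ht1, hx1⟩ := ray_hit hb hcU hu
    obtain ⟨t2, ht2, hx2⟩ := ray_hit hb hcU (neg_ne_zero.2 hu)
    have i1 : ∀ t : ℝ, ⟪c + t • u, (ν : Euc n)⟫ = ⟪a, (ν : Euc n)⟫ := by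
      intro t; rw [inner_add_left, real_inner_smul_left, hu1, hc1]; ring
    have i2 : ∀ t : ℝ, ⟪c + t • u, (ν' : Euc n)⟫ = ⟪a', (ν' : Euc n)⟫ := by
      intro t; rw [inner_add_left, real_inner_smul_left, hu2, hc2]; ring
    rw [smul_neg, ← neg_smul] at hx2
    have e1 := (hQ ν a b ha hb').2 _ hx1 (i1 _)
    have e2 := (hQ ν a b ha hb').2 _ hx2 (i1 _)
    have e1' := (hQ ν' a' b' ha' hb'').2 _ hx1 (i2 _)
    have e2' := (hQ ν' a' b' ha' hb'').2 _ hx2 (i2 _)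
    rw [e1] at e1'
    rw [e2] at e2'
    have h3 : (((Q ν).2 - (Q ν').2) * (t1 + t2)) • u = 0 := by
      have : (((Q ν).2 - (Q ν').2) * (t1 + t2)) • u =
          ((Q ν).1 + (Q ν).2 • (c + t1 • u) - ((Q ν').1 + (Q ν').2 • (c + t1 • u)))
          - ((Q ν).1 + (Q ν).2 • (c + (-t2) • u) - ((Q ν').1 + (Q ν').2 • (c + (-t2) • u))) := by
        module
      rw [this, e1', e2']; simp
    have h4 : (Q ν).2 = (Q ν').2 := by
      have := (mul_eq_zero.1 ((smul_eq_zero.1 h3).resolve_right hu)).resolve_right (by linarith)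
      linarith
    rw [h4] at e1'
    exact Prod.ext (add_right_cancel e1').symm h4.symm
  have hrank : 1 < Module.rank ℝ (Euc n) := by
    rw [← Module.finrank_eq_rank, finrank_euclideanSpace_fin]
    exact_mod_cast (by omega : 1 < n)
  have : PreconnectedSpace (sphere (0 : Euc n) 1) :=
    Subtype.preconnectedSpace (isPreconnected_sphere hrank 0 1)
  -- normalize
  have hnorm : ∀ ν : Euc n, ν ≠ 0 → ∃ ν' : sphere (0 : Euc n) 1, ∃ r : ℝ, 0 < r ∧
      (ν' : Euc n) = r • ν := by
    intro ν hν
    refine ⟨⟨‖ν‖⁻¹ • ν, ?_⟩, ‖ν‖⁻¹, inv_pos.2 (norm_pos_iff.2 hν), rfl⟩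
    simp [norm_smul, hν]
  obtain ⟨k, hk, -, -⟩ := exists_perp hn (0 : Euc n) 0
  obtain ⟨ν0, -⟩ := hnorm k hk
  obtain ⟨q, hq⟩ : ∃ q, q = (Q ν0).1 := ⟨_, rfl⟩
  obtain ⟨l, hl⟩ : ∃ l, l = (Q ν0).2 := ⟨_, rfl⟩
  have hQc : ∀ ν, (Q ν).1 = q ∧ (Q ν).2 = l := fun ν => by
    rw [hloc.apply_eq_of_preconnectedSpace ν ν0, hq, hl]; exact ⟨rfl, rfl⟩
  have hl1 : l = -1 := by
    obtain ⟨a, ha⟩ := exists_supAt hKc hne (ν0 : Euc n)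
    obtain ⟨b, hb'⟩ := exists_supAt hKc hne (-(ν0 : Euc n))
    have h1 := (hQ ν0 a b ha hb').1
    have h2 := (hQ (-ν0) b a (by simpa using hb') (by simpa using ha)).1
    rw [(hQc _).1, (hQc _).2] at h1 h2
    have hab : a - b ≠ 0 := by
      intro h0
      rw [sub_eq_zero] at h0
      obtain ⟨w, hw⟩ := hi
      obtain ⟨z, hz, hlt⟩ := interior_lt hw (hnz ν0)
      have h3 := ha.2 z hz
      have h4 := hb'.2 w (interior_subset hw)
      rw [inner_neg_right, inner_neg_right, ← h0] at h4
      linarith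
    have h3 : (1 + l) • (a - b) = 0 := by
      have : (1 + l) • (a - b) = (a - (q + l • b)) - (b - (q + l • a)) := by module
      rw [this, ← h1, ← h2]; simp
    have := (smul_eq_zero.1 h3).resolve_right hab
    linarith
  have hfin : ∀ ν : Euc n, ν ≠ 0 → ∀ a b, SupAt K ν a → SupAt K (-ν) b → b = q - a ∧
      ∀ x ∈ L, ⟪x, ν⟫ = ⟪a, ν⟫ → f x = q - x := by
    intro ν hν a b ha hb'
    obtain ⟨ν', r, hr, e⟩ := hnorm ν hν
    have h1 := hQ ν' a b (by rw [e]; exact ha.smul hr.le)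
      (by rw [e, ← smul_neg]; exact hb'.smul hr.le)
    rw [(hQc _).1, (hQc _).2, hl1] at h1
    refine ⟨by rw [h1.1]; module, fun x hx hxν => ?_⟩
    rw [h1.2 x hx (by rw [e, real_inner_smul_right, real_inner_smul_right, hxν])]
    module
  refine ⟨q, fun x hx => ?_, fun z hz => ?_⟩
  · obtain ⟨ν, a, hν, ha, hax⟩ := exists_support_through hn hK (hKL x hx)
    obtain ⟨b, hb'⟩ := exists_supAt hKc hne (-ν)
    exact (hfin ν hν a b ha hb').2 x hx hax.symm
  · by_contra hnot
    obtain ⟨ν, -, hν⟩ := sep hKc hc (q - z) 0 (by simpa using hnot)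
    have hν0 : ν ≠ 0 := by
      rintro rfl
      have := hν z hz
      simp at this
    obtain ⟨a, ha⟩ := exists_supAt hKc hne ν
    obtain ⟨b, hb'⟩ := exists_supAt hKc hne (-ν)
    have h1 := (hfin ν hν0 a b ha hb').1
    have h2 := hν a ha.1
    have h3 := hb'.2 z hz
    rw [h1] at h3
    simp only [inner_neg_right, inner_sub_left] at h2 h3
    linarith

/-- In the Setting, if `C_y` is a translate of `C_x` (x, y ∈ L,
y ≠ x), then the grazes `Ω_x = C_x ∩ bd K` and `Ω_y = C_y ∩ bd K` are
inversely homothetic. -/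
theorem stmt_7 (n : ℕ) (hn : 3 ≤ n) (K L : Set (Euc n))
    (hK : IsConvexBody K) (hKs : StrictConvex ℝ K)
    (hL : IsSphereEmbeddingImage (n - 1) L)
    (hcomp : ∃ z ∈ Lᶜ, Bornology.IsBounded (connectedComponentIn Lᶜ z) ∧
      K ⊆ connectedComponentIn Lᶜ z)
    (hcone : ∀ x ∈ L, ∃ y ∈ L, y ≠ x ∧ ∃ p : Euc n,
      supportCone K y = (fun z => p + z) '' supportCone K x)
    (x y : Euc n) (hxL : x ∈ L) (hyL : y ∈ L) (hxy : y ≠ x)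
    (p : Euc n) (hp : supportCone K y = (fun z => p + z) '' supportCone K x) :
    ∃ (c : Euc n) (r : ℝ), r < 0 ∧
      supportCone K y ∩ frontier K =
        (fun z => c + r • (z - c)) '' (supportCone K x ∩ frontier K) := by
  have hLc : IsClosed L := by
    obtain ⟨f, hf, -, rfl⟩ := hL
    exact (isCompact_range hf).isClosed
  obtain ⟨z0, -, hb, hsub⟩ := hcomp
  have hKL : ∀ x ∈ L, x ∉ K := fun x hx hxK => connectedComponentIn_subset _ _ (hsub hxK) hx
  have hpart : ∀ w, ∃ v, w ∈ L → Partner K w v := by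
    intro w
    by_cases hw : w ∈ L
    · obtain ⟨v, hv, hne, p', hp'⟩ := hcone w hw
      exact ⟨v, fun _ => partner_of_translate hn hK (hKL w hw) (hKL v hv) hne hp'⟩
    · exact ⟨0, fun h => absurd h hw⟩
  choose f0 hf0 using hpart
  have hxyP := partner_of_translate hn hK (hKL x hxL) (hKL y hyL) hxy hp
  classical
  obtain ⟨q, hq, hKq⟩ := central hn hK hKs hLc hb hsub (f := Function.update f0 x y) (by
    intro w hw
    by_cases h : w = x
    · subst h; simpa using hxyP
    · rw [Function.update_of_ne h]; exact hf0 w hw)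
  have hy : y = q - x := by
    have := hq x hxL
    rwa [Function.update_self] at this
  have hσK : (Homeomorph.subLeft q) '' K = K := by
    ext w
    constructor
    · rintro ⟨z, hz, rfl⟩; exact hKq z hz
    · intro hw; exact ⟨q - w, hKq w hw, by simp⟩
  have hF : (Homeomorph.subLeft q) '' frontier K = frontier K := by
    rw [Homeomorph.image_frontier, hσK]
  have hD : dirCone K y = dirCone K x := by
    have hz : ∀ (z : Euc n) (t : ℝ), t • (q - z - (q - x)) = (-t) • (z - x) := by
      intro z t; module
    ext v
    rw [hy]
    constructor
    · rintro ⟨z, hz', t, rfl⟩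
      refine ⟨q - z, hKq z hz', -t, ?_⟩
      module
    · rintro ⟨z, hz', t, rfl⟩
      refine ⟨q - z, hKq z hz', -t, ?_⟩
      module
  have hC : (Homeomorph.subLeft q) '' supportCone K x = supportCone K y := by
    ext w
    rw [mem_supportCone, hD]
    have hneg : ∀ v, v ∈ frontier (dirCone K x) → -v ∈ frontier (dirCone K x) := by
      intro v hv
      have := dirCone_frontier_smul (t := -1) (by norm_num) hv
      simpa using this
    constructor
    · rintro ⟨z, hz, rfl⟩
      rw [mem_supportCone] at hz
      have := hneg _ hz
      convert this using 1
      rw [hy]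
      simp only [Homeomorph.subLeft_apply]
      abel
    · intro hw
      refine ⟨q - w, ?_, by simp⟩
      rw [mem_supportCone]
      have := hneg _ hw
      convert this using 1
      rw [hy]
      abel
  refine ⟨(1 / 2 : ℝ) • q, -1, by norm_num, ?_⟩
  have hfun : (fun z : Euc n => (1 / 2 : ℝ) • q + (-1 : ℝ) • (z - (1 / 2 : ℝ) • q)) =
      Homeomorph.subLeft q := by
    funext z
    simp only [Homeomorph.subLeft_apply]
    module
  rw [hfun, Set.image_inter (Homeomorph.subLeft q).injective, hC, hF]
end
end

section
/- Assume the Setting. Let x, y, x̄, ȳ ∈ L with y ≠ x, ȳ ≠ x̄, C_y = p + C_x, and C_ȳ = q + C_x̄ for some p, q ∈ ℝ^n; write Ω_z = C_z ∩ bd K for z ∈ {x, y, x̄, ȳ}. Suppose Ω_x ∩ Ω_x̄ contains at least two distinct points, and suppose Ω_x and Ω_y are homothetic with ratio −1 with center c = (x + y)/2, i.e., Ω_y = {2c − z : z ∈ Ω_x}. Then Ω_x̄ and Ω_ȳ are homothetic with ratio −1 with the same center c, i.e., Ω_ȳ = {2c − z : z ∈ Ω_x̄}, and (x̄ + ȳ)/2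 = c. -/
open Set Metric RealInnerProductSpace

noncomputable section

/-- The bundled properties of a strictly convex body. -/
structure SBody {n : ℕ} (K : Set (Euc n)) : Prop where
  compact : IsCompact K
  convex : Convex ℝ K
  int : (interior K).Nonempty
  strict : StrictConvex ℝ K

/-- The point of `K` at which the linear functional `u` is maximal. -/
def suppPt {n : ℕ} (K : Set (Euc n)) (u : Euc n) : Euc n :=
  Classical.epsilon (fun z => z ∈ K ∧ ∀ k ∈ K, inner ℝ u k ≤ inner ℝ u z)

/-- Unit outer normals of the supporting hyperplanes of `K` through `x`. -/
def nrm {n : ℕ} (K : Set (Euc n)) (x : Euc n) : Set (Euc n) :=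
  {u | ‖u‖ = 1 ∧ (∀ k ∈ K, inner ℝ u k ≤ inner ℝ u x) ∧ ∃ z ∈ K, inner ℝ u z = inner ℝ u x}

theorem SBody.nonempty {n : ℕ} {K : Set (Euc n)} (hK : SBody K) : K.Nonempty :=
  hK.int.mono interior_subset

theorem suppPt_spec {n : ℕ} {K : Set (Euc n)} (hK : SBody K) (u : Euc n) :
    suppPt K u ∈ K ∧ ∀ k ∈ K, inner ℝ u k ≤ inner ℝ u (suppPt K u) := by
  have h : ∃ z, z ∈ K ∧ ∀ k ∈ K, inner ℝ u k ≤ inner ℝ u z := by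
    obtain ⟨z, hz, hm⟩ := hK.compact.exists_isMaxOn hK.nonempty
      (f := fun k => inner ℝ u k) (by fun_prop)
    exact ⟨z, hz, fun k hk => hm hk⟩
  exact Classical.epsilon_spec h

/-- At interior points, a nonzero functional is not maximal. -/
theorem interior_lt_s9 {n : ℕ} {K : Set (Euc n)} {u m : Euc n} (hu : u ≠ 0) (hm : m ∈ interior K)
    {s : ℝ} (hs : ∀ k ∈ K, inner ℝ u k ≤ s) : inner ℝ u m < s := by
  obtain ⟨ε, hε, hb⟩ := Metric.isOpen_iff.1 isOpen_interior m hm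
  have hn : 0 < ‖u‖ := norm_pos_iff.2 hu
  have h1 : m + (ε / (2 * ‖u‖)) • u ∈ K := by
    apply interior_subset
    apply hb
    rw [Metric.mem_ball, dist_eq_norm, add_sub_cancel_left, norm_smul, Real.norm_eq_abs,
      abs_of_pos (by positivity)]
    field_simp
    linarith
  have h2 := hs _ h1
  rw [inner_add_right, inner_smul_right, real_inner_self_eq_norm_sq] at h2
  have : 0 < ε / (2 * ‖u‖) * ‖u‖ ^ 2 := by positivity
  linarith

theorem suppPt_unique {n : ℕ} {K : Set (Euc n)} (hK : SBody K) {u z : Euc n} (hu : u ≠ 0)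
    (hz : z ∈ K) (hm : ∀ k ∈ K, inner ℝ u k ≤ inner ℝ u z) : suppPt K u = z := by
  by_contra hne
  have hs := suppPt_spec hK u
  have h1 : (1 / 2 : ℝ) • suppPt K u + (1 / 2 : ℝ) • z ∈ interior K :=
    hK.strict hs.1 hz hne (by norm_num) (by norm_num) (by norm_num)
  have h2 := interior_lt_s9 hu h1 hm
  rw [inner_add_right, inner_smul_right, inner_smul_right] at h2
  have := hs.2 z hz
  have := hm _ hs.1
  linarith

theorem nrm_ne {n : ℕ} {K : Set (Euc n)} {x u : Euc n} (h : u ∈ nrm K x) : u ≠ 0 := by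
  have := h.1
  rintro rfl
  simp at this

theorem nrm_supp {n : ℕ} {K : Set (Euc n)} (hK : SBody K) {x u : Euc n} (h : u ∈ nrm K x) :
    inner ℝ u (suppPt K u) = inner ℝ u x := by
  obtain ⟨z, hz, he⟩ := h.2.2
  have h1 := (suppPt_spec hK u).2 z hz
  have h2 := h.2.1 _ (suppPt_spec hK u).1
  linarith

theorem nrm_supp_sub {n : ℕ} {K : Set (Euc n)} (hK : SBody K) {x u : Euc n} (h : u ∈ nrm K x) :
    inner ℝ u (suppPt K u - x) = 0 := by
  rw [inner_sub_right, nrm_supp hK h, sub_self]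

theorem nrm_eq_supp {n : ℕ} {K : Set (Euc n)} (hK : SBody K) {x u z : Euc n} (h : u ∈ nrm K x)
    (hz : z ∈ K) (hzz : inner ℝ u (z - x) = 0) : suppPt K u = z := by
  apply suppPt_unique hK (nrm_ne h) hz
  intro k hk
  rw [inner_sub_right] at hzz
  have := h.2.1 k hk
  linarith

theorem mem_nrm {n : ℕ} {K : Set (Euc n)} (hK : SBody K) {x u : Euc n} (h : ‖u‖ = 1)
    (h2 : inner ℝ u (suppPt K u) = inner ℝ u x) : u ∈ nrm K x :=
  ⟨h, fun k hk => h2 ▸ (suppPt_spec hK u).2 k hk, _, (suppPt_spec hK u).1, h2⟩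

theorem suppPt_continuousAt {n : ℕ} {K : Set (Euc n)} (hK : SBody K) {u : Euc n} (hu : u ≠ 0) :
    ContinuousAt (suppPt K) u := by
  apply hK.compact.tendsto_nhds_of_unique_mapClusterPt
  · exact Filter.Eventually.of_forall fun v => (suppPt_spec hK v).1
  · intro z hz hc
    refine (suppPt_unique hK hu hz ?_).symm
    intro k hk
    by_contra hlt
    push Not at hlt
    -- the set of pairs (v, w) with ⟪v, w⟫ < ⟪v, k⟫ is an open neighbourhood of (u, z)
    have hopen : IsOpen {p : Euc n × Euc n | inner ℝ p.1 p.2 < inner ℝ p.1 k} :=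
      isOpen_lt (by fun_prop) (by fun_prop)
    have hmem : {p : Euc n × Euc n | inner ℝ p.1 p.2 < inner ℝ p.1 k} ∈ nhds (u, z) :=
      hopen.mem_nhds hlt
    rw [nhds_prod_eq, Filter.mem_prod_iff] at hmem
    obtain ⟨s, hs, t, ht, hst⟩ := hmem
    have hf := hc.frequently ht
    obtain ⟨v, hv1, hv2⟩ := (hf.and_eventually hs).exists
    have h3 := hst (Set.mk_mem_prod hv2 hv1)
    have := (suppPt_spec hK v).2 k hk
    simp only [Set.mem_ofPred_eq] at h3
    linarith

/-- Strict separation of a point from the body. -/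
theorem exists_sep {n : ℕ} {K : Set (Euc n)} (hK : SBody K) {x : Euc n} (hx : x ∉ K) :
    ∃ e : Euc n, ∀ k ∈ K, 0 < inner ℝ e (k - x) := by
  obtain ⟨f, s, h1, h2⟩ := geometric_hahn_banach_point_closed hK.convex hK.compact.isClosed hx
  refine ⟨(InnerProductSpace.toDual ℝ (Euc n)).symm f, fun k hk => ?_⟩
  rw [InnerProductSpace.toDual_symm_apply, map_sub]
  have := h2 k hk
  linarith

/-- Tilting functional. -/
def tilt_s9 {n : ℕ} (K : Set (Euc n)) (x e d : Euc n) : ℝ :=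
  sSup ((fun k : K => inner ℝ d ((k : Euc n) - x) / inner ℝ e ((k : Euc n) - x)) '' Set.univ)

theorem tilt_continuous {n : ℕ} {K : Set (Euc n)} (hK : SBody K) {x e : Euc n}
    (he : ∀ k ∈ K, 0 < inner ℝ e (k - x)) : Continuous (tilt_s9 K x e) := by
  have : CompactSpace K := isCompact_iff_compactSpace.1 hK.compact
  have := (isCompact_univ (X := K)).continuous_sSup
    (f := fun (d : Euc n) (k : K) =>
      inner ℝ d ((k : Euc n) - x) / inner ℝ e ((k : Euc n) - x)) (by
    refine Continuous.div ?_ ?_ ?_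
    · fun_prop
    · fun_prop
    · rintro ⟨d, k⟩
      exact (he k k.2).ne')
  exact this

theorem tilt_spec {n : ℕ} {K : Set (Euc n)} (hK : SBody K) {x e : Euc n}
    (he : ∀ k ∈ K, 0 < inner ℝ e (k - x)) (d : Euc n) :
    (∀ k ∈ K, inner ℝ (d - tilt_s9 K x e d • e) (k - x) ≤ 0) ∧
    ∃ z ∈ K, inner ℝ (d - tilt_s9 K x e d • e) (z - x) = 0 := by
  have : CompactSpace K := isCompact_iff_compactSpace.1 hK.compact
  have : Nonempty K := hK.nonempty.to_subtype
  have hc : ContinuousOn (fun k : K => inner ℝ d ((k : Euc n) - x) / inner ℝ e ((k : Euc n) - x))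
      Set.univ := by
    apply Continuous.continuousOn
    refine Continuous.div ?_ ?_ ?_
    · fun_prop
    · fun_prop
    · intro k
      exact (he k k.2).ne'
  obtain ⟨z, -, hz, hm⟩ := isCompact_univ.exists_sSup_image_eq_and_ge Set.univ_nonempty hc
  have hz' : tilt_s9 K x e d = _ := hz
  rw [hz']
  constructor
  · intro k hk
    have h1 := hm ⟨k, hk⟩ (Set.mem_univ _)
    rw [div_le_iff₀ (he k hk)] at h1
    rw [inner_sub_left, real_inner_smul_left]
    simpa using h1
  · refine ⟨z, z.2, ?_⟩
    rw [inner_sub_left, real_inner_smul_left]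
    have := (he z z.2).ne'
    field_simp
    simp

theorem normalize_mem {n : ℕ} {K : Set (Euc n)} {x w : Euc n} (hw : w ≠ 0)
    (h1 : ∀ k ∈ K, inner ℝ w (k - x) ≤ 0) (h2 : ∃ z ∈ K, inner ℝ w (z - x) = 0) :
    ‖w‖⁻¹ • w ∈ nrm K x := by
  have hn : 0 < ‖w‖ := norm_pos_iff.2 hw
  refine ⟨?_, ?_, ?_⟩
  · rw [norm_smul, norm_inv, norm_norm, inv_mul_cancel₀ hn.ne']
  · intro k hk
    have := h1 k hk
    rw [inner_sub_right] at this
    rw [real_inner_smul_left, real_inner_smul_left]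
    exact mul_le_mul_of_nonneg_left (by linarith) (by positivity)
  · obtain ⟨z, hz, h⟩ := h2
    refine ⟨z, hz, ?_⟩
    rw [inner_sub_right] at h
    rw [real_inner_smul_left, real_inner_smul_left, sub_eq_zero.1 h]

theorem tilt_ne {n : ℕ} {d e : Euc n} (hd : d ∉ Submodule.span ℝ {e}) (t : ℝ) :
    d - t • e ≠ 0 := by
  intro h
  apply hd
  rw [sub_eq_zero.1 h]
  exact Submodule.smul_mem _ _ (Submodule.mem_span_singleton_self e)

theorem tilt_mem {n : ℕ} {K : Set (Euc n)} (hK : SBody K) {x e : Euc n}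
    (he : ∀ k ∈ K, 0 < inner ℝ e (k - x)) {d : Euc n} (hd : d ∉ Submodule.span ℝ {e}) :
    ‖d - tilt_s9 K x e d • e‖⁻¹ • (d - tilt_s9 K x e d • e) ∈ nrm K x :=
  normalize_mem (tilt_ne hd _) (tilt_spec hK he d).1 (tilt_spec hK he d).2

theorem nrm_not_span {n : ℕ} {K : Set (Euc n)} (hK : SBody K) {x e : Euc n}
    (he : ∀ k ∈ K, 0 < inner ℝ e (k - x)) {u : Euc n} (hu : u ∈ nrm K x) :
    u ∉ Submodule.span ℝ {e} := by
  intro h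
  obtain ⟨s, rfl⟩ := Submodule.mem_span_singleton.1 h
  have h1 := nrm_supp_sub hK hu
  rw [real_inner_smul_left] at h1
  have h2 := he _ (suppPt_spec hK (s • e)).1
  rcases mul_eq_zero.1 h1 with h | h
  · apply nrm_ne hu
    rw [h, zero_smul]
  · linarith

theorem tilt_nrm {n : ℕ} {K : Set (Euc n)} (hK : SBody K) {x e : Euc n}
    (he : ∀ k ∈ K, 0 < inner ℝ e (k - x)) {u : Euc n} (hu : u ∈ nrm K x) :
    tilt_s9 K x e u = 0 := by
  obtain ⟨h1, z, hz, h2⟩ := tilt_spec hK he u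
  have h3 := h1 _ (suppPt_spec hK u).1
  rw [inner_sub_left, nrm_supp_sub hK hu, real_inner_smul_left] at h3
  rw [inner_sub_left, real_inner_smul_left] at h2
  have h4 := he _ (suppPt_spec hK u).1
  have h5 := he _ hz
  have h6 : inner ℝ u (z - x) ≤ 0 := by
    rw [inner_sub_right]
    linarith [hu.2.1 z hz]
  apply le_antisymm
  · by_contra hlt
    push Not at hlt
    nlinarith
  · by_contra hlt
    push Not at hlt
    nlinarith

theorem nrm_preconnected {n : ℕ} (hn : 3 ≤ n) {K : Set (Euc n)} (hK : SBody K) {x : Euc n}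
    (hx : x ∉ K) : IsPreconnected (nrm K x) := by
  obtain ⟨e, he⟩ := exists_sep hK hx
  have hcon : IsConnected ((Submodule.span ℝ {e} : Submodule ℝ (Euc n)) : Set (Euc n))ᶜ := by
    apply isConnected_compl_of_one_lt_codim
    rw [← Module.finrank_eq_rank]
    have h1 := Submodule.finrank_quotient_add_finrank (Submodule.span ℝ {e} : Submodule ℝ (Euc n))
    have h2 : Module.finrank ℝ (Submodule.span ℝ {e} : Submodule ℝ (Euc n)) ≤ 1 :=
      (finrank_span_le_card _).trans (by simp)
    rw [finrank_euclideanSpace_fin] at h1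
    exact_mod_cast (by omega : 1 < Module.finrank ℝ (Euc n ⧸ Submodule.span ℝ {e}))
  have himg : nrm K x = (fun d => ‖d - tilt_s9 K x e d • e‖⁻¹ • (d - tilt_s9 K x e d • e)) ''
      ((Submodule.span ℝ {e} : Submodule ℝ (Euc n)) : Set (Euc n))ᶜ := by
    apply Set.Subset.antisymm
    · intro u hu
      refine ⟨u, nrm_not_span hK he hu, ?_⟩
      simp only [tilt_nrm hK he hu, zero_smul, sub_zero, hu.1, inv_one, one_smul]
    · rintro _ ⟨d, hd, rfl⟩
      exact tilt_mem hK he hd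
  rw [himg]
  apply hcon.isPreconnected.image
  have hc : Continuous (fun d => d - tilt_s9 K x e d • e) :=
    continuous_id.sub ((tilt_continuous hK he).smul continuous_const)
  exact (hc.norm.continuousOn.inv₀ fun d hd => norm_ne_zero_iff.2 (tilt_ne hd _)).smul
    hc.continuousOn

theorem not_nrm_neg {n : ℕ} {K : Set (Euc n)} (hK : SBody K) {x u : Euc n} (hu : u ∈ nrm K x)
    (h : ∀ k ∈ K, inner ℝ (-u) (k - x) ≤ 0) : False := by
  obtain ⟨m, hm⟩ := hK.int
  have h1 := interior_lt_s9 (nrm_ne hu) hm hu.2.1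
  have h2 := h m (interior_subset hm)
  rw [inner_neg_left, inner_sub_right] at h2
  linarith

theorem nrm_nonempty {n : ℕ} (hn : 3 ≤ n) {K : Set (Euc n)} (hK : SBody K) {x : Euc n}
    (hx : x ∉ K) : (nrm K x).Nonempty := by
  obtain ⟨e, he⟩ := exists_sep hK hx
  have : ∃ d, d ∉ (Submodule.span ℝ {e} : Submodule ℝ (Euc n)) := by
    by_contra hcon
    push Not at hcon
    have h0 : (Submodule.span ℝ {e} : Submodule ℝ (Euc n)) = ⊤ := Submodule.eq_top_iff'.2 hcon
    have h2 : Module.finrank ℝ (Submodule.span ℝ {e} : Submodule ℝ (Euc n)) ≤ 1 :=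
      (finrank_span_le_card _).trans (by simp)
    rw [h0, finrank_top, finrank_euclideanSpace_fin] at h2
    omega
  obtain ⟨d, hd⟩ := this
  exact ⟨_, tilt_mem hK he hd⟩

theorem exists_other {n : ℕ} {K : Set (Euc n)} (hK : SBody K) {x : Euc n}
    (hx : x ∉ K) {u : Euc n} (hu : u ∈ nrm K x) :
    ∃ v ∈ nrm K x, suppPt K v ≠ suppPt K u := by
  obtain ⟨e, he⟩ := exists_sep hK hx
  have hd : -u ∉ (Submodule.span ℝ {e} : Submodule ℝ (Euc n)) := by
    rw [Submodule.neg_mem_iff]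
    exact nrm_not_span hK he hu
  refine ⟨_, tilt_mem hK he hd, fun heq => ?_⟩
  have h1 := nrm_supp_sub hK (tilt_mem hK he hd)
  rw [heq, real_inner_smul_left] at h1
  have h2 : inner ℝ (-u - tilt_s9 K x e (-u) • e) (suppPt K u - x) = 0 := by
    rcases mul_eq_zero.1 h1 with h | h
    · exact absurd (inv_eq_zero.1 h) (norm_ne_zero_iff.2 (tilt_ne hd _))
    · exact h
  rw [inner_sub_left, inner_neg_left, nrm_supp_sub hK hu, real_inner_smul_left] at h2
  have h3 : tilt_s9 K x e (-u) = 0 := by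
    have := (he _ (suppPt_spec hK u).1).ne'
    have h4 : tilt_s9 K x e (-u) * inner ℝ e (suppPt K u - x) = 0 := by linarith
    exact (mul_eq_zero.1 h4).resolve_right this
  have h5 := (tilt_spec hK he (-u)).1
  rw [h3] at h5
  simp only [zero_smul, sub_zero] at h5
  exact not_nrm_neg hK hu h5

theorem mem_solidCone {n : ℕ} {K : Set (Euc n)} {x q : Euc n} :
    q ∈ solidCone K x ↔ ∃ k ∈ K, ∃ t : ℝ, q = x + t • (k - x) := by
  unfold solidCone
  simp only [Set.mem_iUnion, SetLike.mem_coe]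
  constructor
  · rintro ⟨k, hk, h⟩
    have h' : (q - x) +ᵥ x ∈ affineSpan ℝ ({x, k} : Set (Euc n)) := by
      rwa [vadd_eq_add, sub_add_cancel]
    obtain ⟨t, ht⟩ := vadd_left_mem_affineSpan_pair.1 h'
    refine ⟨k, hk, t, ?_⟩
    rw [vsub_eq_sub] at ht
    rw [ht, add_sub_cancel]
  · rintro ⟨k, hk, t, rfl⟩
    refine ⟨k, hk, ?_⟩
    rw [add_comm]
    exact vadd_left_mem_affineSpan_pair.2 ⟨t, rfl⟩

theorem solidCone_closed {n : ℕ} {K : Set (Euc n)} (hK : SBody K) {x : Euc n}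
    (hx : x ∉ K) : IsClosed (solidCone K x) := by
  obtain ⟨e, he⟩ := exists_sep hK hx
  have : CompactSpace K := isCompact_iff_compactSpace.1 hK.compact
  have hcl : IsClosed {p : Euc n × K | inner ℝ e ((p.2 : Euc n) - x) • (p.1 - x) =
      inner ℝ e (p.1 - x) • ((p.2 : Euc n) - x)} :=
    isClosed_eq (by fun_prop) (by fun_prop)
  have h := isClosedMap_fst_of_compactSpace _ hcl
  convert h using 1
  ext q
  rw [mem_solidCone]
  constructor
  · rintro ⟨k, hk, t, rfl⟩
    refine ⟨(_, ⟨k, hk⟩), ?_, rfl⟩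
    change _ = _
    simp only [add_sub_cancel_left, inner_smul_right, smul_smul]
    rw [mul_comm]
  · rintro ⟨⟨q', k⟩, h, rfl⟩
    change _ = _ at h
    refine ⟨k, k.2, inner ℝ e (q' - x) / inner ℝ e ((k : Euc n) - x), ?_⟩
    have h0 := (he k k.2).ne'
    simp only at h ⊢
    rw [div_eq_inv_mul, mul_smul, ← h, smul_smul, inv_mul_cancel₀ h0, one_smul,
      add_sub_cancel]

theorem supportCone_apex {n : ℕ} (hn : 3 ≤ n) {K : Set (Euc n)} (hK : SBody K) {x : Euc n}
    (hx : x ∉ K) {u : Euc n} (hu : u ∈ nrm K x) (t : ℝ) :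
    x + t • (suppPt K u - x) ∈ supportCone K x := by
  obtain ⟨e, he⟩ := exists_sep hK hx
  have hz := (suppPt_spec hK u).1
  have hez := he _ hz
  have huz := nrm_supp_sub hK hu
  have key : ∀ t : ℝ, t ≠ 0 → x + t • (suppPt K u - x) ∈ supportCone K x := by
    intro t ht
    rw [supportCone, frontier, Set.mem_sdiff]
    refine ⟨subset_closure (mem_solidCone.2 ⟨_, hz, t, rfl⟩), fun hinter => ?_⟩
    have hcont : Filter.Tendsto (fun ε : ℝ => x + t • (suppPt K u - x) + (ε * t) • u)
        (nhds 0) (nhds (x + t • (suppPt K u - x))) := by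
      have : Continuous (fun ε : ℝ => x + t • (suppPt K u - x) + (ε * t) • u) := by fun_prop
      simpa using this.tendsto 0
    have h1 := hcont.eventually (isOpen_interior.mem_nhds hinter)
    have hcont2 : Filter.Tendsto (fun ε : ℝ => inner ℝ e (suppPt K u - x) + ε * inner ℝ e u)
        (nhds 0) (nhds (inner ℝ e (suppPt K u - x))) := by
      have : Continuous (fun ε : ℝ => inner ℝ e (suppPt K u - x) + ε * inner ℝ e u) := by fun_prop
      simpa using this.tendsto 0
    have h2 := hcont2.eventually (isOpen_Ioi.mem_nhds (show _ ∈ Set.Ioi 0 from hez))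
    obtain ⟨δ, hδ, hb⟩ := Metric.eventually_nhds_iff.1 (h1.and h2)
    have h3 := @hb (δ / 2) (by rw [Real.dist_eq, sub_zero, abs_of_pos (by linarith)]; linarith)
    obtain ⟨h4, h5⟩ := h3
    obtain ⟨k, hk, s, hs⟩ := mem_solidCone.1 (interior_subset h4)
    have hs' : t • (suppPt K u - x) + (δ / 2 * t) • u = s • (k - x) := by
      have := congrArg (fun q => q - x) hs
      simpa [add_assoc] using this
    have e1 := congrArg (fun q => inner ℝ u q) hs'
    have e2 := congrArg (fun q => inner ℝ e q) hs'
    simp only [inner_add_right, inner_smul_right, huz, real_inner_self_eq_norm_sq, hu.1] at e1 e2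
    have hk1 : inner ℝ u (k - x) ≤ 0 := by
      rw [inner_sub_right]
      linarith [hu.2.1 k hk]
    have hk2 := he k hk
    have h5' : 0 < inner ℝ e (suppPt K u - x) + δ / 2 * inner ℝ e u := h5
    have e2' : t * (inner ℝ e (suppPt K u - x) + δ / 2 * inner ℝ e u) =
      s * inner ℝ e (k - x) := by linarith
    rcases lt_or_gt_of_ne ht with h | h
    · have hs0 : s < 0 := by
        by_contra hc
        push Not at hc
        nlinarith [mul_nonneg hc hk2.le, mul_neg_of_neg_of_pos h h5']
      nlinarith [mul_nonneg_of_nonpos_of_nonpos hs0.le hk1, mul_neg_of_neg_of_pos h hδ]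
    · have hs0 : 0 < s := by
        by_contra hc
        push Not at hc
        nlinarith [mul_nonneg (neg_nonneg.2 hc) hk2.le, mul_pos h h5']
      nlinarith [mul_nonneg hs0.le (neg_nonneg.2 hk1), mul_pos h hδ]
  by_cases ht : t = 0
  · subst ht
    have hcl : IsClosed {s : ℝ | x + s • (suppPt K u - x) ∈ supportCone K x} :=
      isClosed_frontier.preimage (f := fun s : ℝ => x + s • (suppPt K u - x)) (by fun_prop)
    have hsub : ({0}ᶜ : Set ℝ) ⊆ {s : ℝ | x + s • (suppPt K u - x) ∈ supportCone K x} :=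
      fun s hs => key s hs
    have := hcl.closure_subset_iff.2 hsub
    rw [(dense_compl_singleton (0 : ℝ)).closure_eq] at this
    exact this (Set.mem_univ 0)
  · exact key t ht

theorem supportCone_sub {n : ℕ} (hn : 3 ≤ n) {K : Set (Euc n)} (hK : SBody K) {x : Euc n}
    (hx : x ∉ K) {q : Euc n} (hq : q ∈ supportCone K x) :
    ∃ u ∈ nrm K x, ∃ t : ℝ, q = x + t • (suppPt K u - x) := by
  have hqs : q ∈ solidCone K x := (solidCone_closed hK hx).frontier_subset hq
  obtain ⟨k, hk, t, rfl⟩ := mem_solidCone.1 hqs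
  by_cases ht : t = 0
  · obtain ⟨u, hu⟩ := nrm_nonempty hn hK hx
    exact ⟨u, hu, 0, by simp [ht]⟩
  have hO : Convex ℝ {v : Euc n | ∃ s : ℝ, 0 < s ∧ x + s • v ∈ interior K} := by
    rintro v ⟨s, hs, hv⟩ w ⟨r, hr, hw⟩ a b ha hb hab
    have hD : 0 < a * r + b * s := by
      rcases ha.eq_or_lt with h | h
      · subst h
        have : b = 1 := by linarith
        subst this
        simpa using hs
      · have := mul_pos h hr
        have := mul_nonneg hb hs.le
        linarith
    refine ⟨s * r / (a * r + b * s), by positivity, ?_⟩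
    have := hK.convex.interior hv hw (a := a * r / (a * r + b * s))
      (b := b * s / (a * r + b * s)) (by positivity) (by positivity) (by field_simp)
    convert this using 1
    have e1 : x = (a * r / (a * r + b * s)) • x + (b * s / (a * r + b * s)) • x := by
      rw [← add_smul, ← add_div, div_self hD.ne', one_smul]
    have e2 : (s * r / (a * r + b * s)) • (a • v + b • w) =
      (a * r / (a * r + b * s)) • s • v + (b * s / (a * r + b * s)) • r • w := by
      simp only [smul_add, smul_smul]
      congr 2 <;> ring
    rw [e2, smul_add, smul_add]
    nth_rewrite 1 [e1]
    abel
  have hOo : IsOpen {v : Euc n | ∃ s : ℝ, 0 < s ∧ x + s • v ∈ interior K} := by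
    have : {v : Euc n | ∃ s : ℝ, 0 < s ∧ x + s • v ∈ interior K} =
        ⋃ s : ℝ, ⋃ _ : 0 < s, (fun v => x + s • v) ⁻¹' interior K := by
      ext v
      simp
    rw [this]
    exact isOpen_iUnion fun s => isOpen_iUnion fun _ => isOpen_interior.preimage (by fun_prop)
  have hnot : k - x ∉ {v : Euc n | ∃ s : ℝ, 0 < s ∧ x + s • v ∈ interior K} := by
    rintro ⟨s, hs, hi⟩
    refine hq.2 ?_
    have hopen : IsOpen ((fun q => x + (s / t) • (q - x)) ⁻¹' interior K) :=
      isOpen_interior.preimage (by fun_prop)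
    refine interior_maximal (s := solidCone K x) ?_ hopen ?_
    · intro q hq
      refine mem_solidCone.2 ⟨_, interior_subset hq, t / s, ?_⟩
      rw [add_sub_cancel_left, smul_smul]
      have : t / s * (s / t) = 1 := by field_simp
      rw [this, one_smul, add_sub_cancel]
    · change x + (s / t) • (x + t • (k - x) - x) ∈ interior K
      rw [add_sub_cancel_left, smul_smul]
      have : s / t * t = s := by field_simp
      rwa [this]
  obtain ⟨f, hf⟩ := geometric_hahn_banach_open_point hO hOo hnot
  have hcone : ∀ m ∈ interior K, ∀ r : ℝ, 0 < r → r * f (m - x) < f (k - x) := by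
    intro m hm r hr
    have := hf (r • (m - x)) ⟨r⁻¹, by positivity, by
      rwa [smul_smul, inv_mul_cancel₀ hr.ne', one_smul, add_sub_cancel]⟩
    simpa using this
  obtain ⟨m, hm⟩ := hK.int
  have h0 : 0 ≤ f (k - x) := by
    by_contra hlt
    push Not at hlt
    have h1 := hcone m hm 1 one_pos
    have h2 : f (m - x) < 0 := by linarith
    have h3 := hcone m hm (f (k - x) / (2 * f (m - x))) (by
      apply div_pos_of_neg_of_neg <;> linarith)
    have h4 : f (k - x) / (2 * f (m - x)) * f (m - x) = f (k - x) / 2 := by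
      have := h2.ne
      field_simp
    linarith
  have hneg : ∀ m ∈ interior K, f (m - x) ≤ 0 := by
    intro m hm
    by_contra hlt
    push Not at hlt
    have h3 := hcone m hm ((f (k - x) + 1) / f (m - x)) (by positivity)
    rw [div_mul_cancel₀ _ hlt.ne'] at h3
    linarith
  have hneg2 : ∀ m ∈ K, f (m - x) ≤ 0 := by
    have hcl : IsClosed {m : Euc n | f (m - x) ≤ 0} :=
      isClosed_le (by fun_prop) continuous_const
    have h1 : closure (interior K) ⊆ {m : Euc n | f (m - x) ≤ 0} :=
      hcl.closure_subset_iff.2 hneg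
    rw [hK.convex.closure_interior_eq_closure_of_nonempty_interior hK.int] at h1
    exact fun m hm => h1 (subset_closure hm)
  have hk0 : f (k - x) = 0 := le_antisymm (hneg2 k hk) h0
  set w := (InnerProductSpace.toDual ℝ (Euc n)).symm f with hw
  have hwf : ∀ v, inner ℝ w v = f v := fun v => InnerProductSpace.toDual_symm_apply
  have hw0 : w ≠ 0 := by
    intro h
    have h1 := hcone m hm 1 one_pos
    rw [hk0, ← hwf, h] at h1
    simp at h1
  have hu : ‖w‖⁻¹ • w ∈ nrm K x := normalize_mem hw0 (fun m hm => by rw [hwf]; exact hneg2 m hm)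
    ⟨k, hk, by rw [hwf, hk0]⟩
  refine ⟨_, hu, t, ?_⟩
  rw [nrm_eq_supp hK hu hk (by rw [real_inner_smul_left, hwf, hk0, mul_zero])]

theorem mem_supportCone_s9 {n : ℕ} (hn : 3 ≤ n) {K : Set (Euc n)} (hK : SBody K) {x : Euc n}
    (hx : x ∉ K) {q : Euc n} : q ∈ supportCone K x ↔
    ∃ u ∈ nrm K x, ∃ t : ℝ, q = x + t • (suppPt K u - x) := by
  constructor
  · exact supportCone_sub hn hK hx
  · rintro ⟨u, hu, t, rfl⟩
    exact supportCone_apex hn hK hx hu t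

theorem graze_eq {n : ℕ} (hn : 3 ≤ n) {K : Set (Euc n)} (hK : SBody K) {x : Euc n}
    (hx : x ∉ K) : supportCone K x ∩ frontier K = suppPt K '' nrm K x := by
  ext z
  constructor
  · rintro ⟨h1, h2⟩
    obtain ⟨u, hu, t, rfl⟩ := (mem_supportCone_s9 hn hK hx).1 h1
    refine ⟨u, hu, nrm_eq_supp hK hu (hK.compact.isClosed.frontier_subset h2) ?_⟩
    rw [add_sub_cancel_left, inner_smul_right, nrm_supp_sub hK hu, mul_zero]
  · rintro ⟨u, hu, rfl⟩
    refine ⟨?_, ?_, ?_⟩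
    · have := supportCone_apex hn hK hx hu 1
      simpa using this
    · exact subset_closure (suppPt_spec hK u).1
    · intro hi
      exact lt_irrefl _ (interior_lt_s9 (nrm_ne hu) hi (suppPt_spec hK u).2)

/-- The support double cone translated so that its apex is the origin. -/
def inB {n : ℕ} (K : Set (Euc n)) (x v : Euc n) : Prop :=
  ∃ u ∈ nrm K x, ∃ t : ℝ, v = t • (suppPt K u - x)

theorem inB_smul {n : ℕ} {K : Set (Euc n)} {x v : Euc n} (h : inB K x v) (s : ℝ) :
    inB K x (s • v) := by
  obtain ⟨u, hu, t, rfl⟩ := h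
  exact ⟨u, hu, s * t, by rw [smul_smul]⟩

theorem inB_eq_zero {n : ℕ} {K : Set (Euc n)} (hK : SBody K) {x e v : Euc n}
    (he : ∀ k ∈ K, 0 < inner ℝ e (k - x)) (h : inB K x v) (h0 : inner ℝ e v = 0) : v = 0 := by
  obtain ⟨u, hu, t, rfl⟩ := h
  rw [inner_smul_right] at h0
  rcases mul_eq_zero.1 h0 with h | h
  · rw [h, zero_smul]
  · exact absurd h (he _ (suppPt_spec hK u).1).ne'

theorem inB_supp {n : ℕ} {K : Set (Euc n)} {x u : Euc n} (hu : u ∈ nrm K x) :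
    inB K x (suppPt K u - x) := ⟨u, hu, 1, by rw [one_smul]⟩

theorem apex_eq_s9 {n : ℕ} (hn : 3 ≤ n) {K : Set (Euc n)} (hK : SBody K) {x y r : Euc n}
    (hx : x ∉ K) (h : ∀ v, inB K x v ↔ inB K y (v + r)) : r = 0 := by
  by_contra hr
  obtain ⟨e, he⟩ := exists_sep hK hx
  obtain ⟨u, hu⟩ := nrm_nonempty hn hK hx
  obtain ⟨u', hu', hne⟩ := exists_other hK hx hu
  have h1 : ∀ v, inB K x v → ∀ s : ℝ, s ≠ 0 → inB K y (v + s • r) := by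
    intro v hv s hs
    have := inB_smul ((h _).1 (inB_smul hv s⁻¹)) s
    rwa [smul_add, smul_smul, mul_inv_cancel₀ hs, one_smul] at this
  have h2 : ∀ v, inB K x v → ∀ s : ℝ, s ≠ -1 → inB K x (v + s • r) := by
    intro v hv s hs
    rw [h]
    have := h1 v hv (s + 1) (fun h => hs (by linarith))
    rwa [add_smul, one_smul, ← add_assoc] at this
  have hr0 : inB K x r := by
    have h0 : inB K x 0 := by
      have := inB_smul (inB_supp hu) 0
      rwa [zero_smul] at this
    have := h2 0 h0 1 (by norm_num)
    rwa [zero_add, one_smul] at this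
  have her : inner ℝ e r ≠ 0 := fun h0 => hr (inB_eq_zero hK he hr0 h0)
  have h3 : ∀ v, inB K x v → ∃ s : ℝ, v = s • r := by
    intro v hv
    by_cases hs : -(inner ℝ e v / inner ℝ e r) = -1
    · have h4 := h2 _ (inB_smul hv 2) (-(2 * (inner ℝ e v / inner ℝ e r))) (by linarith)
      have h5 := inB_eq_zero hK he h4 (by
        rw [inner_add_right, inner_smul_right, inner_smul_right]
        field_simp
        ring)
      refine ⟨inner ℝ e v / inner ℝ e r, ?_⟩
      have h6 : (2 : ℝ) • (v - (inner ℝ e v / inner ℝ e r) • r) = 0 := by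
        rw [← h5]
        module
      have := (smul_eq_zero.1 h6).resolve_left (by norm_num)
      exact sub_eq_zero.1 this
    · have h4 := h2 _ hv _ hs
      have h5 := inB_eq_zero hK he h4 (by
        rw [inner_add_right, inner_smul_right]
        field_simp
        ring)
      refine ⟨inner ℝ e v / inner ℝ e r, ?_⟩
      rw [neg_smul] at h5
      rw [← sub_eq_add_neg] at h5
      exact sub_eq_zero.1 h5
  obtain ⟨α, hα⟩ := h3 _ (inB_supp hu)
  obtain ⟨β, hβ⟩ := h3 _ (inB_supp hu')
  have h7 := nrm_supp_sub hK hu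
  rw [hα, inner_smul_right] at h7
  have hα0 : α ≠ 0 := by
    rintro rfl
    rw [zero_smul] at hα
    have := he _ (suppPt_spec hK u).1
    rw [hα] at this
    simp at this
  have h8 : inner ℝ u r = 0 := (mul_eq_zero.1 h7).resolve_left hα0
  apply hne
  refine (nrm_eq_supp hK hu (suppPt_spec hK u').1 ?_).symm
  rw [hβ, inner_smul_right, h8, mul_zero]

theorem sigma_main {n : ℕ} (hn : 3 ≤ n) {K : Set (Euc n)} (hK : SBody K) {x y e σ : _}
    (hx : x ∉ K) (he : ∀ k ∈ K, 0 < inner ℝ e (k - y)) (h : ∀ v : Euc n, inB K x v ↔ inB K y v)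
    (hσ : |σ| = 1) (hs : ∀ u ∈ nrm K x, 0 < σ * inner ℝ e (suppPt K u - x)) :
    ∀ u ∈ nrm K y, σ • u ∈ nrm K x ∧
      ∃ s : ℝ, 0 < s ∧ suppPt K u - y = (σ * s) • (suppPt K (σ • u) - x) := by
  intro u hu
  have hσ2 : σ * σ = 1 := by
    rw [← abs_mul_abs_self, hσ, one_mul]
  -- the functional is nonpositive on boundary directions
  have h1 : ∀ u' ∈ nrm K x, inner ℝ (σ • u) (suppPt K u' - x) ≤ 0 := by
    intro u' hu'
    obtain ⟨w, hw, t, ht⟩ := (h _).1 (inB_supp hu')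
    have h2 := hs u' hu'
    rw [ht, inner_smul_right] at h2
    have h3 := he _ (suppPt_spec hK w).1
    have h4 : 0 < σ * t := by
      by_contra hc
      push Not at hc
      nlinarith [mul_nonneg (neg_nonneg.2 hc) h3.le]
    rw [ht, real_inner_smul_left, inner_smul_right, inner_sub_right]
    have h5 := hu.2.1 _ (suppPt_spec hK w).1
    nlinarith [mul_nonneg h4.le (sub_nonneg.2 h5)]
  obtain ⟨e', he'⟩ := exists_sep hK hx
  have h2 : ∀ k ∈ K, inner ℝ (σ • u) (k - x) ≤ 0 := by
    by_cases hsp : σ • u ∈ Submodule.span ℝ {e'}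
    · obtain ⟨s, hs'⟩ := Submodule.mem_span_singleton.1 hsp
      obtain ⟨u0, hu0⟩ := nrm_nonempty hn hK hx
      have h3 := h1 u0 hu0
      intro k hk
      rw [← hs', real_inner_smul_left] at h3 ⊢
      have h4 := he' _ (suppPt_spec hK u0).1
      have h5 := he' k hk
      have : s ≤ 0 := by
        by_contra hc
        push Not at hc
        nlinarith
      exact mul_nonpos_of_nonpos_of_nonneg this h5.le
    · have hm := tilt_mem hK he' hsp
      have h3 := h1 _ hm
      have h4 := nrm_supp_sub hK hm
      set z := suppPt K (‖σ • u - tilt_s9 K x e' (σ • u) • e'‖⁻¹ •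
        (σ • u - tilt_s9 K x e' (σ • u) • e')) with hz
      have hzK : z ∈ K := (suppPt_spec hK _).1
      rw [real_inner_smul_left] at h4
      have h5 := (mul_eq_zero.1 h4).resolve_left
        (inv_ne_zero (norm_ne_zero_iff.2 (tilt_ne hsp _)))
      rw [inner_sub_left, real_inner_smul_left e' _ (tilt_s9 K x e' (σ • u))] at h5
      have h6 := he' z hzK
      have h7 : tilt_s9 K x e' (σ • u) ≤ 0 := by
        by_contra hc
        push Not at hc
        nlinarith
      intro k hk
      have h8 := (tilt_spec hK he' (σ • u)).1 k hk
      rw [inner_sub_left, real_inner_smul_left e' _ (tilt_s9 K x e' (σ • u))] at h8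
      have h9 := he' k hk
      nlinarith [mul_nonneg (neg_nonneg.2 h7) h9.le]
  obtain ⟨w, hw, t, ht⟩ := (h _).2 (inB_supp hu)
  have h3 := he _ (suppPt_spec hK u).1
  have h4 := hs w hw
  have ht' := ht
  rw [ht, inner_smul_right] at h3
  have htσ : 0 < σ * t := by
    by_contra hc
    push Not at hc
    have e1 : σ * t * (σ * inner ℝ e (suppPt K w - x)) = t * inner ℝ e (suppPt K w - x) := by
      rw [show σ * t * (σ * inner ℝ e (suppPt K w - x)) =
        (σ * σ) * (t * inner ℝ e (suppPt K w - x)) by ring, hσ2, one_mul]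
    have := mul_nonneg (neg_nonneg.2 hc) h4.le
    linarith
  have h5 := nrm_supp_sub hK hu
  rw [ht, inner_smul_right] at h5
  have h6 : inner ℝ u (suppPt K w - x) = 0 := by
    refine (mul_eq_zero.1 h5).resolve_left ?_
    rintro rfl
    simp at htσ
  have h7 : inner ℝ (σ • u) (suppPt K w - x) = 0 := by
    rw [real_inner_smul_left, h6, mul_zero]
  have hmem : σ • u ∈ nrm K x := by
    refine ⟨by rw [norm_smul, Real.norm_eq_abs, hσ, hu.1, one_mul], ?_, _,
      (suppPt_spec hK w).1, ?_⟩
    · intro k hk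
      have := h2 k hk
      rw [inner_sub_right] at this
      linarith
    · rw [inner_sub_right] at h7
      linarith
  refine ⟨hmem, σ * t, htσ, ?_⟩
  rw [nrm_eq_supp hK hmem (suppPt_spec hK w).1 h7, ht', ← mul_assoc, hσ2, one_mul]

theorem partner_B {n : ℕ} (hn : 3 ≤ n) {K : Set (Euc n)} (hK : SBody K) {x y p : Euc n}
    (hx : x ∉ K) (hy : y ∉ K)
    (hp : supportCone K y = (fun z => p + z) '' supportCone K x) (v : Euc n) :
    inB K x v ↔ inB K y v := by
  have hx' : ∀ v, inB K x v ↔ x + v ∈ supportCone K x := by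
    intro v
    rw [mem_supportCone_s9 hn hK hx]
    simp only [add_right_inj]
    rfl
  have hy' : ∀ v, inB K y v ↔ y + v ∈ supportCone K y := by
    intro v
    rw [mem_supportCone_s9 hn hK hy]
    simp only [add_right_inj]
    rfl
  have h : ∀ v, inB K x v ↔ inB K y (v + (p + x - y)) := by
    intro v
    rw [hx', hy', hp]
    have : y + (v + (p + x - y)) = p + (x + v) := by abel
    rw [this]
    exact ((add_right_injective p).mem_set_image (s := supportCone K x)).symm
  have h0 := apex_eq_s9 hn hK hx h
  rw [h v, h0, add_zero]

theorem partner {n : ℕ} (hn : 3 ≤ n) {K : Set (Euc n)} (hK : SBody K) {x y p : Euc n}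
    (hx : x ∉ K) (hy : y ∉ K) (hxy : y ≠ x)
    (hp : supportCone K y = (fun z => p + z) '' supportCone K x) :
    ∀ u ∈ nrm K y, -u ∈ nrm K x ∧
      ∃ s : ℝ, 0 < s ∧ suppPt K u = y - s • (suppPt K (-u) - x) := by
  have hB := partner_B hn hK hx hy hp
  obtain ⟨e, he⟩ := exists_sep hK hy
  have hne : ∀ u ∈ nrm K x, inner ℝ e (suppPt K u - x) ≠ 0 := by
    intro u hu h0
    have := inB_eq_zero hK he ((hB _).1 (inB_supp hu)) h0
    apply hx
    rw [← sub_eq_zero.1 this]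
    exact (suppPt_spec hK u).1
  have hcont : ContinuousOn (fun u => inner ℝ e (suppPt K u - x)) (nrm K x) := by
    intro u hu
    apply ContinuousAt.continuousWithinAt
    have := suppPt_continuousAt hK (nrm_ne hu)
    fun_prop
  by_cases hpos : ∃ u ∈ nrm K x, 0 < inner ℝ e (suppPt K u - x)
  · exfalso
    obtain ⟨u0, hu0, h0⟩ := hpos
    have hall : ∀ u ∈ nrm K x, 0 < (1 : ℝ) * inner ℝ e (suppPt K u - x) := by
      intro u hu
      rw [one_mul]
      by_contra hc
      push Not at hc
      obtain ⟨w, hw, hw0⟩ := (nrm_preconnected hn hK hx).intermediate_value hu hu0 hcont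
        ⟨hc, h0.le⟩
      exact hne w hw hw0
    have hm := sigma_main hn hK hx he hB (abs_one) hall
    simp only [one_smul, one_mul] at hm
    obtain ⟨u1, hu1⟩ := nrm_nonempty hn hK hy
    obtain ⟨u2, hu2, hne2⟩ := exists_other hK hy hu1
    obtain ⟨hu1x, s1, -, h1⟩ := hm u1 hu1
    obtain ⟨-, s2, -, h2⟩ := hm u2 hu2
    have e1 : (1 - s1) • (suppPt K u1 - x) = y - x := by
      have : y = suppPt K u1 - s1 • (suppPt K u1 - x) := by rw [← h1]; abel
      rw [this]
      module
    have e2 : (1 - s2) • (suppPt K u2 - x) = y - x := by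
      have : y = suppPt K u2 - s2 • (suppPt K u2 - x) := by rw [← h2]; abel
      rw [this]
      module
    have e3 := congrArg (fun q => inner ℝ u1 q) (e2.trans e1.symm)
    simp only [inner_smul_right, nrm_supp_sub hK hu1x, mul_zero] at e3
    rcases mul_eq_zero.1 e3 with h | h
    · rw [h, zero_smul] at e2
      exact hxy (sub_eq_zero.1 e2.symm)
    · exact hne2 (nrm_eq_supp hK hu1x (suppPt_spec hK u2).1 h).symm
  · push Not at hpos
    have hall : ∀ u ∈ nrm K x, 0 < (-1 : ℝ) * inner ℝ e (suppPt K u - x) := by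
      intro u hu
      have := lt_of_le_of_ne (hpos u hu) (hne u hu)
      linarith
    have hm := sigma_main hn hK hx he hB (by simp) hall
    intro u hu
    obtain ⟨h1, s, hs, h2⟩ := hm u hu
    simp only [neg_smul, one_smul, neg_mul, one_mul] at h1 h2
    refine ⟨h1, s, hs, ?_⟩
    rw [sub_eq_iff_eq_add.1 h2]
    abel

theorem partner' {n : ℕ} (hn : 3 ≤ n) {K : Set (Euc n)} (hK : SBody K) {x y p : Euc n}
    (hx : x ∉ K) (hy : y ∉ K) (hxy : y ≠ x)
    (hp : supportCone K y = (fun z => p + z) '' supportCone K x) :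
    ∀ u ∈ nrm K x, -u ∈ nrm K y ∧
      ∃ s : ℝ, 0 < s ∧ suppPt K (-u) = y - s • (suppPt K u - x) := by
  have hp' : supportCone K x = (fun z => -p + z) '' supportCone K y := by
    rw [hp, Set.image_image]
    simp
  intro u hu
  have h1 := (partner hn hK hy hx hxy.symm hp' u hu).1
  refine ⟨h1, ?_⟩
  have h2 := (partner hn hK hx hy hxy hp _ h1).2
  rwa [neg_neg] at h2

/-- A ray starting in a bounded component of the complement of `L` meets `L`. -/
theorem ray_hits {n : ℕ} {L : Set (Euc n)} {z a v : Euc n}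
    (hb : Bornology.IsBounded (connectedComponentIn Lᶜ z))
    (ha : a ∈ connectedComponentIn Lᶜ z) (hv : v ≠ 0) : ∃ t : ℝ, 0 < t ∧ a + t • v ∈ L := by
  by_contra hcon
  push Not at hcon
  have haL : a ∈ Lᶜ := connectedComponentIn_subset _ _ ha
  have hpre : IsPreconnected ((fun t : ℝ => a + t • v) '' Set.Ici 0) :=
    isPreconnected_Ici.image _ (by fun_prop)
  have hsub : (fun t : ℝ => a + t • v) '' Set.Ici 0 ⊆ Lᶜ := by
    rintro _ ⟨t, ht, rfl⟩
    rcases (show (0 : ℝ) ≤ t from ht).eq_or_lt with h | h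
    · subst h
      simpa using haL
    · exact hcon t h
  have h1 := hpre.subset_connectedComponentIn (x := a) ⟨0, Set.mem_Ici.2 le_rfl, by simp⟩ hsub
  rw [← connectedComponentIn_eq ha] at h1
  obtain ⟨R, hR⟩ := (hb.subset h1).exists_norm_le
  have hn : 0 < ‖v‖ := norm_pos_iff.2 hv
  have hR0 : ‖a‖ ≤ R := hR a ⟨0, Set.mem_Ici.2 le_rfl, by simp⟩
  have hq0 : 0 ≤ (R + ‖a‖ + 1) / ‖v‖ := by
    apply div_nonneg _ hn.le
    linarith [norm_nonneg a]
  have h2 := hR (a + ((R + ‖a‖ + 1) / ‖v‖) • v)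
    ⟨_, Set.mem_Ici.2 hq0, rfl⟩
  have h3 : ‖((R + ‖a‖ + 1) / ‖v‖) • v‖ = R + ‖a‖ + 1 := by
    rw [norm_smul, Real.norm_eq_abs, abs_of_nonneg hq0]
    field_simp
  have h4 : ‖((R + ‖a‖ + 1) / ‖v‖) • v‖ ≤ ‖a + ((R + ‖a‖ + 1) / ‖v‖) • v‖ + ‖a‖ := by
    have := norm_sub_le (a + ((R + ‖a‖ + 1) / ‖v‖) • v) a
    rwa [add_sub_cancel_left] at this
  linarith

/-- Two vectors of `ℝ^n`, `n ≥ 3`, have a common orthogonal direction. -/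
theorem exists_orth {n : ℕ} (hn : 3 ≤ n) (u1 u2 : Euc n) :
    ∃ v : Euc n, v ≠ 0 ∧ inner ℝ u1 v = 0 ∧ inner ℝ u2 v = 0 := by
  classical
  have h2 : Module.finrank ℝ (Submodule.span ℝ {u1, u2} : Submodule ℝ (Euc n)) ≤ 2 :=
    (finrank_span_le_card _).trans (by
      rw [← Set.ncard_eq_toFinset_card']
      exact (Set.ncard_insert_le _ _).trans (by simp))
  have h1 := (Submodule.span ℝ {u1, u2} : Submodule ℝ (Euc n)).finrank_add_finrank_orthogonal
  rw [finrank_euclideanSpace_fin] at h1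
  have h3 : (Submodule.span ℝ {u1, u2} : Submodule ℝ (Euc n))ᗮ ≠ ⊥ := by
    intro h
    rw [h, finrank_bot] at h1
    omega
  obtain ⟨v, hv, hv0⟩ := Submodule.exists_mem_ne_zero_of_ne_bot h3
  refine ⟨v, hv0, ?_, ?_⟩
  · exact (Submodule.mem_orthogonal _ _).1 hv _ (Submodule.subset_span (by simp))
  · exact (Submodule.mem_orthogonal _ _).1 hv _ (Submodule.subset_span (by simp))

/-- The bundled setting. -/
structure Stg {n : ℕ} (K L : Set (Euc n)) : Prop where
  hn : 3 ≤ n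
  body : SBody K
  closed : IsClosed L
  comp : ∃ z ∈ Lᶜ, Bornology.IsBounded (connectedComponentIn Lᶜ z) ∧
      K ⊆ connectedComponentIn Lᶜ z
  cone : ∀ x ∈ L, ∃ y ∈ L, y ≠ x ∧ ∃ p : Euc n,
      supportCone K y = (fun z => p + z) '' supportCone K x

theorem Stg.not_mem {n : ℕ} {K L : Set (Euc n)} (S : Stg K L) {x : Euc n} (hx : x ∈ L) :
    x ∉ K := by
  obtain ⟨z, hz, hb, hKs⟩ := S.comp
  exact fun h => connectedComponentIn_subset _ _ (hKs h) hx

theorem Stg.partner {n : ℕ} {K L : Set (Euc n)} (S : Stg K L) {x : Euc n} (hx : x ∈ L) :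
    ∃ y, ∀ u ∈ nrm K x, -u ∈ nrm K y ∧
      ∃ s : ℝ, 0 < s ∧ suppPt K (-u) = y - s • (suppPt K u - x) := by
  obtain ⟨y, hy, hxy, p, hp⟩ := S.cone x hx
  exact ⟨y, partner' S.hn S.body (S.not_mem hx) (S.not_mem hy) hxy hp⟩

/-- The antipode of a boundary point is well defined. -/
theorem Stg.antipode {n : ℕ} {K L : Set (Euc n)} (S : Stg K L) {u1 u2 : Euc n}
    (h1 : ‖u1‖ = 1) (h2 : ‖u2‖ = 1) (h : suppPt K u1 = suppPt K u2) :
    suppPt K (-u1) = suppPt K (-u2) := by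
  have hK := S.body
  obtain ⟨v, hv, hv1, hv2⟩ := exists_orth S.hn u1 u2
  obtain ⟨z, hz, hb, hKs⟩ := S.comp
  obtain ⟨t, ht, hw⟩ := ray_hits hb (hKs (suppPt_spec hK u1).1) hv
  obtain ⟨y, hy⟩ := S.partner hw
  have m1 : u1 ∈ nrm K (suppPt K u1 + t • v) := by
    apply mem_nrm hK h1
    rw [inner_add_right, inner_smul_right, hv1, mul_zero, add_zero]
  have m2 : u2 ∈ nrm K (suppPt K u1 + t • v) := by
    apply mem_nrm hK h2
    rw [inner_add_right, inner_smul_right, hv2, mul_zero, add_zero, h]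
  obtain ⟨-, s1, -, e1⟩ := hy u1 m1
  obtain ⟨n2, -, -, -⟩ := hy u2 m2
  refine (nrm_eq_supp hK n2 (suppPt_spec hK (-u1)).1 ?_).symm
  rw [e1]
  have : y - s1 • (suppPt K u1 - (suppPt K u1 + t • v)) - y = (s1 * t) • v := by module
  rw [this, inner_smul_right, inner_neg_left, hv2, neg_zero, mul_zero]

/-- Two nearby normals at `x` share a further point of `L` on both their hyperplanes. -/
theorem Stg.exists_common {n : ℕ} {K L : Set (Euc n)} (S : Stg K L) {x u2 : Euc n} (hx : x ∈ L)
    (hu2 : u2 ∈ nrm K x) : ∀ᶠ u1 in nhdsWithin u2 (nrm K x), u1 ≠ u2 →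
      ∃ w ∈ L, w ≠ x ∧ inner ℝ u1 (w - x) = 0 ∧ inner ℝ u2 (w - x) = 0 := by
  have hK := S.body
  obtain ⟨z, hz, hb, hKs⟩ := S.comp
  have hopen : IsOpen (connectedComponentIn Lᶜ z) := S.closed.isOpen_compl.connectedComponentIn
  obtain ⟨ε, hε, hball⟩ := Metric.isOpen_iff.1 hopen _ (hKs (suppPt_spec hK u2).1)
  have hc1 : ∀ᶠ u1 in nhds u2, dist (suppPt K u1) (suppPt K u2) < ε / 2 :=
    (suppPt_continuousAt hK (nrm_ne hu2)).eventually (Metric.ball_mem_nhds _ (by positivity))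
  have hc2 : ∀ᶠ u1 in nhds u2, 0 < inner ℝ u1 u2 := by
    have hc : Continuous (fun u1 : Euc n => inner ℝ u1 u2) := by fun_prop
    refine hc.continuousAt.eventually (isOpen_Ioi.mem_nhds ?_)
    change (0 : ℝ) < inner ℝ u2 u2
    rw [real_inner_self_eq_norm_sq, hu2.1]
    norm_num
  filter_upwards [self_mem_nhdsWithin, nhdsWithin_le_nhds hc1, nhdsWithin_le_nhds hc2]
    with u1 hu1 hd hs hne
  set s := inner ℝ u1 u2 with hsdef
  set v := suppPt K u2 - x with hv
  have n1 : inner ℝ u1 u1 = 1 := by rw [real_inner_self_eq_norm_sq, hu1.1]; norm_num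
  have n2 : inner ℝ u2 u2 = 1 := by rw [real_inner_self_eq_norm_sq, hu2.1]; norm_num
  have hs' : inner ℝ u2 u1 = s := real_inner_comm _ _
  have hnd : ‖u1 - u2‖ ^ 2 = 2 * (1 - s) := by
    rw [← real_inner_self_eq_norm_sq]
    simp only [inner_sub_left, inner_sub_right, n1, n2, hs', ← hsdef]
    ring
  have hs1 : 0 < 1 - s := by
    have : 0 < ‖u1 - u2‖ := norm_pos_iff.2 (sub_ne_zero.2 hne)
    have : 0 < ‖u1 - u2‖ ^ 2 := by positivity
    linarith
  have hD : 0 < 1 - s ^ 2 := by nlinarith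
  have hvu2 : inner ℝ u2 v = 0 := nrm_supp_sub hK hu2
  set α := inner ℝ u1 v with hα
  set g := u1 - s • u2 with hg
  have hgu1 : inner ℝ u1 g = 1 - s ^ 2 := by
    rw [hg, inner_sub_right, inner_smul_right, n1, ← hsdef]
    ring
  have hgu2 : inner ℝ u2 g = 0 := by
    rw [hg, inner_sub_right, inner_smul_right, n2, hs']
    ring
  have hgn : ‖g‖ ^ 2 = 1 - s ^ 2 := by
    rw [← real_inner_self_eq_norm_sq]
    nth_rewrite 1 [hg]
    rw [inner_sub_left, real_inner_smul_left, hgu1, hgu2]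
    ring
  -- size of α
  have hαb : |α| ≤ ‖u1 - u2‖ * ‖suppPt K u1 - suppPt K u2‖ := by
    have a1 : α = inner ℝ u1 (suppPt K u2) - inner ℝ u1 (suppPt K u1) := by
      rw [hα, hv, inner_sub_right, nrm_supp hK hu1]
    have a2 := (suppPt_spec hK u1).2 _ (suppPt_spec hK u2).1
    have a3 := (suppPt_spec hK u2).2 _ (suppPt_spec hK u1).1
    have a4 := real_inner_le_norm (u1 - u2) (suppPt K u1 - suppPt K u2)
    simp only [inner_sub_left, inner_sub_right] at a4
    rw [abs_le]
    constructor <;> linarith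
  have hnear : ‖(α / (1 - s ^ 2)) • g‖ < ε := by
    have b1 : ‖(α / (1 - s ^ 2)) • g‖ ^ 2 = α ^ 2 / (1 - s ^ 2) := by
      rw [norm_smul, mul_pow, hgn, Real.norm_eq_abs, sq_abs]
      field_simp
    have b2 : α ^ 2 ≤ (2 * (1 - s)) * ‖suppPt K u1 - suppPt K u2‖ ^ 2 := by
      rw [← hnd, ← mul_pow, ← sq_abs α]
      exact pow_le_pow_left₀ (abs_nonneg _) hαb 2
    have b3 : α ^ 2 / (1 - s ^ 2) ≤ 2 * ‖suppPt K u1 - suppPt K u2‖ ^ 2 := by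
      rw [div_le_iff₀ hD]
      have : 0 ≤ ‖suppPt K u1 - suppPt K u2‖ ^ 2 := by positivity
      nlinarith [mul_nonneg this (mul_nonneg hs.le hs1.le)]
    rw [dist_eq_norm] at hd
    have b4 : ‖suppPt K u1 - suppPt K u2‖ ^ 2 < (ε / 2) ^ 2 :=
      pow_lt_pow_left₀ hd (norm_nonneg _) (by norm_num)
    refine lt_of_pow_lt_pow_left₀ 2 hε.le ?_
    rw [b1]
    nlinarith
  set v' := v - (α / (1 - s ^ 2)) • g with hv'
  have hU : x + v' ∈ connectedComponentIn Lᶜ z := by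
    apply hball
    rw [Metric.mem_ball, dist_eq_norm]
    have : x + v' - suppPt K u2 = -((α / (1 - s ^ 2)) • g) := by
      rw [hv', hv]
      abel
    rw [this, norm_neg]
    exact hnear
  have hv0 : v' ≠ 0 := by
    intro h
    rw [h, add_zero] at hU
    exact connectedComponentIn_subset _ _ hU hx
  obtain ⟨t, ht, hw⟩ := ray_hits hb hU hv0
  have hwx : x + v' + t • v' - x = (1 + t) • v' := by module
  refine ⟨_, hw, ?_, ?_, ?_⟩
  · intro h
    rw [← sub_eq_zero, hwx] at h
    rcases smul_eq_zero.1 h with h | h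
    · linarith
    · exact hv0 h
  · rw [hwx, inner_smul_right, hv', inner_sub_right, inner_smul_right, hgu1, ← hα,
      div_mul_cancel₀ _ hD.ne', sub_self, mul_zero]
  · rw [hwx, inner_smul_right, hv', inner_sub_right, inner_smul_right, hgu2, hvu2]
    ring

theorem Stg.same_ratio {n : ℕ} {K L : Set (Euc n)} (S : Stg K L) {x y w u1 u2 : Euc n}
    (hw : w ∈ L) (hwx : w ≠ x) (hu1 : u1 ∈ nrm K x) (hu2 : u2 ∈ nrm K x)
    (h1 : inner ℝ u1 (w - x) = 0) (h2 : inner ℝ u2 (w - x) = 0)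
    (hne : suppPt K u1 ≠ suppPt K u2) {l1 l2 : ℝ}
    (e1 : suppPt K (-u1) = y - l1 • (suppPt K u1 - x))
    (e2 : suppPt K (-u2) = y - l2 • (suppPt K u2 - x)) : l1 = l2 := by
  have hK := S.body
  have m1 : u1 ∈ nrm K w := by
    apply mem_nrm hK hu1.1
    rw [inner_sub_right] at h1
    rw [nrm_supp hK hu1]
    linarith
  have m2 : u2 ∈ nrm K w := by
    apply mem_nrm hK hu2.1
    rw [inner_sub_right] at h2
    rw [nrm_supp hK hu2]
    linarith
  obtain ⟨w', hw'⟩ := S.partner hw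
  obtain ⟨-, k1, -, f1⟩ := hw' u1 m1
  obtain ⟨-, k2, -, f2⟩ := hw' u2 m2
  have key : l1 • (suppPt K u1 - x) - k1 • (suppPt K u1 - x) + k1 • (w - x) =
      l2 • (suppPt K u2 - x) - k2 • (suppPt K u2 - x) + k2 • (w - x) := by
    have g1 : l1 • (suppPt K u1 - x) - k1 • (suppPt K u1 - w) = y - w' := by
      have : y = w' - k1 • (suppPt K u1 - w) + l1 • (suppPt K u1 - x) := by
        rw [← f1, e1]; abel
      rw [this]; abel
    have g2 : l2 • (suppPt K u2 - x) - k2 • (suppPt K u2 - w) = y - w' := by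
      have : y = w' - k2 • (suppPt K u2 - w) + l2 • (suppPt K u2 - x) := by
        rw [← f2, e2]; abel
      rw [this]; abel
    have := g1.trans g2.symm
    calc _ = l1 • (suppPt K u1 - x) - k1 • (suppPt K u1 - w) := by module
      _ = _ := this
      _ = _ := by module
  have c1 := congrArg (fun q => inner ℝ u1 q) key
  have c2 := congrArg (fun q => inner ℝ u2 q) key
  simp only [inner_add_right, inner_sub_right (𝕜 := ℝ) _ (_ • _) (_ • _), inner_smul_right,
    nrm_supp_sub hK hu1, nrm_supp_sub hK hu2, h1, h2] at c1 c2
  have d1 : inner ℝ u1 (suppPt K u2 - x) ≠ 0 := fun h =>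
    hne (nrm_eq_supp hK hu1 (suppPt_spec hK u2).1 h)
  have d2 : inner ℝ u2 (suppPt K u1 - x) ≠ 0 := fun h =>
    hne (nrm_eq_supp hK hu2 (suppPt_spec hK u1).1 h).symm
  have r2 : l2 = k2 := by
    have : (l2 - k2) * inner ℝ u1 (suppPt K u2 - x) = 0 := by linarith
    linarith [(mul_eq_zero.1 this).resolve_right d1]
  have r1 : l1 = k1 := by
    have : (l1 - k1) * inner ℝ u2 (suppPt K u1 - x) = 0 := by linarith
    linarith [(mul_eq_zero.1 this).resolve_right d2]
  rw [← r1, ← r2, sub_self, sub_self, zero_add, zero_add] at key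
  have : (l1 - l2) • (w - x) = 0 := by rw [sub_smul, key, sub_self]
  rcases smul_eq_zero.1 this with h | h
  · linarith
  · exact absurd (sub_eq_zero.1 h) hwx

/-- In the Setting, if the grazes `Ω_x` and `Ω_x̄` share at least
two points and `Ω_x`, `Ω_y` are homothetic with ratio `-1` and center
`c = (x + y)/2`, then `Ω_x̄`, `Ω_ȳ` are homothetic with ratio `-1` and the
same center `c`, and `(x̄ + ȳ)/2 = c`. -/
theorem stmt_9 (n : ℕ) (hn : 3 ≤ n) (K L : Set (Euc n))
    (hK : IsConvexBody K) (hKs : StrictConvex ℝ K)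
    (hL : IsSphereEmbeddingImage (n - 1) L)
    (hcomp : ∃ z ∈ Lᶜ, Bornology.IsBounded (connectedComponentIn Lᶜ z) ∧
      K ⊆ connectedComponentIn Lᶜ z)
    (hcone : ∀ x ∈ L, ∃ y ∈ L, y ≠ x ∧ ∃ p : Euc n,
      supportCone K y = (fun z => p + z) '' supportCone K x)
    (x y xbar ybar : Euc n)
    (hxL : x ∈ L) (hyL : y ∈ L) (hxbarL : xbar ∈ L) (hybarL : ybar ∈ L)
    (hxy : y ≠ x) (hxybar : ybar ≠ xbar)
    (p q : Euc n)
    (hp : supportCone K y = (fun z => p + z) '' supportCone K x)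
    (hq : supportCone K ybar = (fun z => q + z) '' supportCone K xbar)
    (a b : Euc n) (hab : a ≠ b)
    (ha : a ∈ (supportCone K x ∩ frontier K) ∩ (supportCone K xbar ∩ frontier K))
    (hb : b ∈ (supportCone K x ∩ frontier K) ∩ (supportCone K xbar ∩ frontier K))
    (c : Euc n) (hc : c = (1 / 2 : ℝ) • (x + y))
    (hhom : supportCone K y ∩ frontier K =
      (fun z => (2 : ℝ) • c - z) '' (supportCone K x ∩ frontier K)) :
    supportCone K ybar ∩ frontier K =
      (fun z => (2 : ℝ) • c - z) '' (supportCone K xbar ∩ frontier K) ∧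
    (1 / 2 : ℝ) • (xbar + ybar) = c := by
  have hLc : IsClosed L := by
    obtain ⟨f, hf, -, rfl⟩ := hL
    exact (isCompact_range hf).isClosed
  have S : Stg K L := ⟨hn, ⟨hK.1, hK.2.1, hK.2.2, hKs⟩, hLc, hcomp, hcone⟩
  have B := S.body
  have nx := S.not_mem hxL
  have ny := S.not_mem hyL
  have nxb := S.not_mem hxbarL
  have nyb := S.not_mem hybarL
  rw [graze_eq hn B nx, graze_eq hn B nxb] at ha hb
  rw [graze_eq hn B nx, graze_eq hn B ny] at hhom
  rw [graze_eq hn B nxb, graze_eq hn B nyb]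
  have h2c : (2 : ℝ) • c = x + y := by rw [hc]; module
  have P := partner' hn B nx ny hxy hp
  have Pb := partner' hn B nxb nyb hxybar hq
  -- antipodes of contact points from `x`
  have A1 : ∀ u ∈ nrm K x, suppPt K (-u) = (2 : ℝ) • c - suppPt K u := by
    intro u hu
    have hm := (P u hu).1
    have h1 : (2 : ℝ) • c - suppPt K u ∈ suppPt K '' nrm K y := by
      rw [hhom]
      exact ⟨_, ⟨u, hu, rfl⟩, rfl⟩
    obtain ⟨w, -, hw⟩ := h1
    apply nrm_eq_supp B hm
    · rw [← hw]
      exact (suppPt_spec B w).1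
    · have : (2 : ℝ) • c - suppPt K u - y = -(suppPt K u - x) := by rw [h2c]; abel
      rw [this, inner_neg_neg, nrm_supp_sub B hu]
  -- the same for common contact points
  obtain ⟨⟨ua, hua, hua'⟩, ⟨va, hva, hva'⟩⟩ := ha
  obtain ⟨⟨ub, hub, hub'⟩, ⟨vb, hvb, hvb'⟩⟩ := hb
  have Aa : suppPt K (-va) = (2 : ℝ) • c - a := by
    rw [S.antipode hva.1 hua.1 (hva'.trans hua'.symm), A1 ua hua, hua']
  have Ab : suppPt K (-vb) = (2 : ℝ) • c - b := by
    rw [S.antipode hvb.1 hub.1 (hvb'.trans hub'.symm), A1 ub hub, hub']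
  obtain ⟨-, la, -, ea⟩ := Pb va hva
  obtain ⟨-, lb, -, eb⟩ := Pb vb hvb
  rw [hva', Aa] at ea
  rw [hvb', Ab] at eb
  have fa : (la - 1) • (a - xbar) = xbar + ybar - (2 : ℝ) • c := by
    have : (2 : ℝ) • c = ybar - la • (a - xbar) + a := by rw [← ea]; abel
    rw [this]; module
  have fb : (lb - 1) • (b - xbar) = xbar + ybar - (2 : ℝ) • c := by
    have : (2 : ℝ) • c = ybar - lb • (b - xbar) + b := by rw [← eb]; abel
    rw [this]; module
  have hsum : xbar + ybar = (2 : ℝ) • c := by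
    have g := congrArg (fun q => inner ℝ va q) (fa.trans fb.symm)
    have ha0 : inner ℝ va (a - xbar) = 0 := by
      have := nrm_supp_sub B hva
      rwa [hva'] at this
    simp only [inner_smul_right, ha0, mul_zero] at g
    rcases mul_eq_zero.1 g.symm with h | h
    · rw [h, zero_smul] at fb
      exact sub_eq_zero.1 fb.symm
    · have hbK : b ∈ K := hvb' ▸ (suppPt_spec B vb).1
      exact absurd (hva'.symm.trans (nrm_eq_supp B hva hbK h)) hab
  -- propagate along the connected set of normals
  have key : ∀ u ∈ nrm K xbar, ∀ v ∈ nrm K xbar,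
      (suppPt K (-u) = (2 : ℝ) • c - suppPt K u ↔ suppPt K (-v) = (2 : ℝ) • c - suppPt K v) := by
    intro u hu v hv
    refine (nrm_preconnected hn B nxb).induction₂
      (fun u v => suppPt K (-u) = (2 : ℝ) • c - suppPt K u ↔
        suppPt K (-v) = (2 : ℝ) • c - suppPt K v) ?_ ?_ ?_ hu hv
    · intro u2 hu2
      filter_upwards [S.exists_common hxbarL hu2, self_mem_nhdsWithin] with u1 h hu1
      by_cases hz : suppPt K u1 = suppPt K u2
      · rw [S.antipode hu1.1 hu2.1 hz, hz]
      · obtain ⟨w, hwL, hwx, hw1, hw2⟩ := h (fun h => hz (by rw [h]))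
        obtain ⟨-, l1, -, e1⟩ := Pb u1 hu1
        obtain ⟨-, l2, -, e2⟩ := Pb u2 hu2
        have hl := S.same_ratio hwL hwx hu1 hu2 hw1 hw2 hz e1 e2
        have crit : ∀ u ∈ nrm K xbar, suppPt K (-u) = ybar - l1 • (suppPt K u - xbar) →
            (suppPt K (-u) = (2 : ℝ) • c - suppPt K u ↔ l1 = 1) := by
          intro u _ he
          rw [he, ← hsum]
          constructor
          · intro h
            have : (1 - l1) • (suppPt K u - xbar) = 0 := by
              have h' : (ybar - l1 • (suppPt K u - xbar)) - (xbar + ybar - suppPt K u) = 0 := by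
                rw [h, sub_self]
              rw [← h']; module
            rcases smul_eq_zero.1 this with h | h
            · linarith
            · exact absurd (sub_eq_zero.1 h ▸ (suppPt_spec B u).1) nxb
          · rintro h
            rw [h]; module
        rw [← hl] at e2
        rw [crit u1 hu1 e1, crit u2 hu2 e2]
    · intro _ _ _ _ _ _ h1 h2
      exact h1.trans h2
    · intro _ _ _ _ h
      exact h.symm
  have hall : ∀ u ∈ nrm K xbar, suppPt K (-u) = (2 : ℝ) • c - suppPt K u := by
    intro u hu
    exact (key va hva u hu).1 (by rw [Aa, hva'])
  refine ⟨?_, ?_⟩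
  · ext z
    constructor
    · rintro ⟨u, hu, rfl⟩
      have hm := (partner hn B nxb nyb hxybar hq u hu).1
      refine ⟨_, ⟨-u, hm, rfl⟩, ?_⟩
      have := hall _ hm
      rw [neg_neg] at this
      exact this.symm
    · rintro ⟨_, ⟨u, hu, rfl⟩, rfl⟩
      exact ⟨-u, (Pb u hu).1, hall u hu⟩
  · rw [hsum, smul_smul]
    norm_num
end
end
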